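/- Let F be a convex cone subequation on ℝⁿ satisfying condition (F3), let Ω ⊂ ℝⁿ be a bounded domain with smooth strictly F-convex boundary, and let x₀ ∈ Ω. Assume (H1): h ∈ C(Ω̄) is F-harmonic on Ω ∖ {x₀} with a downward-pointing singularity of finite type at x₀, normalized so that h(x₀) = 0, h > 0 on Ω̄ ∖ {x₀}, and sup_{∂Ω} h = 1. Assume (H3): for every function H that is F-subharmonic in a neighborhood of x₀ and F-harmonic on a deleted neighborhood of x₀, the h-density Θ_{x₀}(H) := lim_{x→x₀} (H(x) − H(x₀))/h(x) exists and is ≥ 0. Assume (H4): if H is F-harmonic in a full neighborhood of x₀, then Θ_{x₀}(H) = 0. Then for every Θ ≥ 0 and every φ ∈ C(∂Ω) there exists a unique H ∈ C(Ω̄) that is F-harmonic on Ω ∖ {x₀}, satisfies H = φ on ∂Ω, and has h-density Θ_{x₀}(H) = Θ. -/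

import Mathlib

open scoped Topology Classical
open Filter

noncomputable section

/-- Euclidean space ℝⁿ. -/
abbrev EucSp (n : ℕ) := EuclideanSpace ℝ (Fin n)

/-- The space Sym²(ℝⁿ) of symmetric real n×n matrices, with its subspace topology. -/
abbrev SymMat (n : ℕ) := selfAdjoint (Matrix (Fin n) (Fin n) ℝ)

variable {n : ℕ}

/-- The matrix of the orthogonal projection onto the line ℝ·e (for a unit vector e). -/
def projMat (e : EucSp n) : Matrix (Fin n) (Fin n) ℝ := Matrix.of fun i j => e i * e j

lemma projMat_selfAdjoint (e : EucSp n) :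
    projMat e ∈ selfAdjoint (Matrix (Fin n) (Fin n) ℝ) := by
  rw [selfAdjoint.mem_iff]
  ext i j
  simp [projMat, Matrix.star_apply, mul_comm]

/-- P_e, the projection onto ℝ·e, as an element of Sym²(ℝⁿ). -/
def symProj (e : EucSp n) : SymMat n := ⟨projMat e, projMat_selfAdjoint e⟩

/-- The matrix P_{e⊥} − (p−1)·P_e. -/
def charMatM (p : ℝ) (e : EucSp n) : Matrix (Fin n) (Fin n) ℝ :=
  (1 - projMat e) - (p - 1) • projMat e

lemma charMatM_selfAdjoint (p : ℝ) (e : EucSp n) :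
    charMatM p e ∈ selfAdjoint (Matrix (Fin n) (Fin n) ℝ) := by
  have h := projMat_selfAdjoint e
  rw [selfAdjoint.mem_iff] at h ⊢
  simp [charMatM, star_sub, star_smul, star_one, h]

/-- P_{e⊥} − (p−1)·P_e as an element of Sym²(ℝⁿ). -/
def charMat (p : ℝ) (e : EucSp n) : SymMat n := ⟨charMatM p e, charMatM_selfAdjoint p e⟩

/-- A (constant coefficient, pure second order) cone subequation on ℝⁿ: a nonempty,
closed, proper subset of Sym²(ℝⁿ) satisfying positivity (F1) and the cone property (F2). -/
structure ConeSubequation (n : ℕ) where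
  carrier : Set (SymMat n)
  nonempty' : carrier.Nonempty
  proper' : carrier ≠ Set.univ
  isClosed' : IsClosed carrier
  f1 : ∀ A ∈ carrier, ∀ P : SymMat n, (P : Matrix (Fin n) (Fin n) ℝ).PosSemidef → A + P ∈ carrier
  f2 : ∀ A ∈ carrier, ∀ t : ℝ, 0 < t → t • A ∈ carrier

/-- The dual of a set of symmetric matrices: F̃ = {A : −A ∉ Int F}. -/
def dualSet (S : Set (SymMat n)) : Set (SymMat n) := {A | -A ∉ interior S}

/-- The subequation P = {A ≥ 0} of positive semidefinite matrices. -/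
def PosP (n : ℕ) : Set (SymMat n) := {A | (A : Matrix (Fin n) (Fin n) ℝ).PosSemidef}

/-- The Hessian matrix (D²f)(x) of a real function on ℝⁿ. -/
def hessMatrix (f : EucSp n → ℝ) (x : EucSp n) : Matrix (Fin n) (Fin n) ℝ :=
  Matrix.of fun i j =>
    iteratedFDeriv ℝ 2 f x ![EuclideanSpace.single i 1, EuclideanSpace.single j 1]

/-- ψ is a test function for u at x₀ (relative to the set X): ψ is C² near x₀,
u ≤ ψ near x₀ (within X), and u(x₀) = ψ(x₀). -/
def IsTestAt (X : Set (EucSp n)) (u : EucSp n → EReal) (ψ : EucSp n → ℝ) (x₀ : EucSp n) :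
    Prop :=
  ContDiffAt ℝ 2 ψ x₀ ∧ (∀ᶠ x in 𝓝[X] x₀, u x ≤ (ψ x : EReal)) ∧ u x₀ = (ψ x₀ : EReal)

/-- u admits no test functions at x₀ (relative to X). -/
def NoTestAt (X : Set (EucSp n)) (u : EucSp n → EReal) (x₀ : EucSp n) : Prop :=
  ∀ ψ : EucSp n → ℝ, ¬ IsTestAt X u ψ x₀

/-- u is S-subharmonic on X (viscosity sense): u is upper semicontinuous on X with values
in [−∞,∞), and for every test function ψ for u at a point of X, the Hessian of ψ there
lies in S. -/
def FSubharmonicOn (S : Set (SymMat n)) (X : Set (EucSp n)) (u : EucSp n → EReal) : Prop :=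
  UpperSemicontinuousOn u X ∧ (∀ x ∈ X, u x ≠ ⊤) ∧
    ∀ x₀ ∈ X, ∀ ψ : EucSp n → ℝ, IsTestAt X u ψ x₀ →
      hessMatrix ψ x₀ ∈ Subtype.val '' S

/-- u is F-harmonic on X: u is F-subharmonic and −u is F̃-subharmonic on X. -/
def FHarmonicOn (F : ConeSubequation n) (X : Set (EucSp n)) (u : EucSp n → EReal) : Prop :=
  FSubharmonicOn F.carrier X u ∧ FSubharmonicOn (dualSet F.carrier) X (fun x => -u x)

/-- u is subaffine on X, i.e. P̃-subharmonic on X. -/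
def SubaffineOn (X : Set (EucSp n)) (u : EucSp n → EReal) : Prop :=
  FSubharmonicOn (dualSet (PosP n)) X u

/-- h is a downward-pointing singular F-harmonic at x₀ on the neighborhood U:
continuous, F-subharmonic on U, F-harmonic on U∖{x₀}, with a strict minimum at x₀, and
either of polar type (h(x₀) = −∞) or of finite type (h(x₀) > −∞, no test functions at x₀). -/
structure DPSingular (F : ConeSubequation n) (U : Set (EucSp n)) (x₀ : EucSp n)
    (h : EucSp n → EReal) : Prop where
  isOpen' : IsOpen U
  mem : x₀ ∈ U
  cont : ContinuousOn h U
  subh : FSubharmonicOn F.carrier U h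
  harm : FHarmonicOn F (U \ {x₀}) h
  strictMin : ∀ x ∈ U, x ≠ x₀ → h x₀ < h x
  polarOrFinite : h x₀ = ⊥ ∨ (h x₀ ≠ ⊥ ∧ NoTestAt U h x₀)

/-- Polar-case asymptotic equivalence H ≈ h at x₀: h − C ≤ H ≤ h + C near x₀. -/
def PolarAsymp (H : EucSp n → ℝ) (h : EucSp n → EReal) (x₀ : EucSp n) : Prop :=
  ∃ C : ℝ, ∀ᶠ x in 𝓝[≠] x₀, h x - (C : EReal) ≤ (H x : EReal) ∧ (H x : EReal) ≤ h x + (C : EReal)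

/-- Finite-case asymptotic equivalence H ∼ h at x₀:
lim_{x→x₀} (H(x) − H(x₀))/(h(x) − h(x₀)) = 1. -/
def FiniteAsymp (H : EucSp n → ℝ) (h : EucSp n → EReal) (x₀ : EucSp n) : Prop :=
  Tendsto (fun x => (H x - H x₀) / ((h x).toReal - (h x₀).toReal)) (𝓝[≠] x₀) (𝓝 1)

/-- Ω is a bounded domain: open, connected and bounded. -/
def IsBoundedDomain (Ω : Set (EucSp n)) : Prop :=
  IsOpen Ω ∧ IsConnected Ω ∧ Bornology.IsBounded Ω

/-- Condition (F3): −P_e ∉ F for every unit vector e. -/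
def CondF3 (F : ConeSubequation n) : Prop :=
  ∀ e : EucSp n, ‖e‖ = 1 → -(symProj e) ∉ F.carrier

/-- The inward unit normal −∇ρ(x)/|∇ρ(x)| of the hypersurface {ρ = 0} bounding {ρ < 0}. -/
def innerNormal (ρ : EucSp n → ℝ) (x : EucSp n) : EucSp n :=
  -(‖gradient ρ x‖⁻¹ • gradient ρ x)

/-- The second fundamental form of {ρ = 0} at x with respect to the inward normal,
extended by zero on the normal line: the tangential part of Hess ρ(x)/|∇ρ(x)|. -/
def secondFF (ρ : EucSp n → ℝ) (x : EucSp n) : Matrix (Fin n) (Fin n) ℝ :=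
  ‖gradient ρ x‖⁻¹ •
    ((1 - projMat (innerNormal ρ x)) * hessMatrix ρ x * (1 - projMat (innerNormal ρ x)))

/-- Ω has smooth boundary which is strictly F-convex: Ω is globally defined by a smooth
defining function ρ with nonvanishing gradient along ∂Ω, and at every boundary point
II_x + t·P_{ν(x)} ∈ Int F for all sufficiently large t. -/
def StrictlyConvexBoundary (F : ConeSubequation n) (Ω : Set (EucSp n)) : Prop :=
  ∃ ρ : EucSp n → ℝ, ContDiff ℝ (⊤ : ℕ∞) ρ ∧ Ω = {x | ρ x < 0} ∧
    ∀ x ∈ frontier Ω, gradient ρ x ≠ 0 ∧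
      ∃ t₀ : ℝ, ∀ t ≥ t₀,
        secondFF ρ x + t • projMat (innerNormal ρ x) ∈ Subtype.val '' interior F.carrier

/-- F is invariant under O(n): gᵀ A g ∈ F for every orthogonal g and A ∈ F. -/
def OrthInvariant (F : ConeSubequation n) : Prop :=
  ∀ g : Matrix (Fin n) (Fin n) ℝ, g.transpose * g = 1 →
    ∀ A ∈ F.carrier, ∀ B : SymMat n,
      (B : Matrix (Fin n) (Fin n) ℝ) = g.transpose * (A : Matrix (Fin n) (Fin n) ℝ) * g →
      B ∈ F.carrier

/-- F has Riesz characteristic p: P_{e⊥} − (p−1)P_e ∈ ∂F for every unit vector e. -/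
def HasRieszChar (F : ConeSubequation n) (p : ℝ) : Prop :=
  ∀ e : EucSp n, ‖e‖ = 1 → charMat p e ∈ frontier F.carrier

/-- The Riesz kernel K_p. -/
def rieszKernel (p : ℝ) (x : EucSp n) : ℝ :=
  if p = 2 then Real.log ‖x‖ else -(p - 2)⁻¹ * ‖x‖ ^ (2 - p)

instance symMat_continuousSMul : ContinuousSMul ℝ (SymMat n) :=
  Topology.IsInducing.subtypeVal.continuousSMul (f := id) continuous_id (fun {_ _} => rfl)

/-- The inclusion of the symmetric matrices into all matrices, as a linear map. -/
def symMatVal : SymMat n →ₗ[ℝ] Matrix (Fin n) (Fin n) ℝ where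
  toFun A := A
  map_add' _ _ := rfl
  map_smul' _ _ := rfl

instance symMat_locallyConvexSpace : LocallyConvexSpace ℝ (SymMat n) :=
  haveI : LocallyConvexSpace ℝ (Matrix (Fin n) (Fin n) ℝ) :=
    inferInstanceAs (LocallyConvexSpace ℝ (Fin n → Fin n → ℝ))
  LocallyConvexSpace.induced (symMatVal (n := n))

/-- The quadratic form of a symmetric matrix. -/
def symQuad (A : SymMat n) (v : EucSp n) : ℝ := ∑ i, ∑ j, v i * A.1 i j * v j

/-- Positive semidefiniteness of a symmetric matrix, in terms of its quadratic form. -/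
def SymPSD (A : SymMat n) : Prop := ∀ v : EucSp n, 0 ≤ symQuad A v

lemma SymPSD.posSemidef {A : SymMat n} (h : SymPSD A) : (A : Matrix (Fin n) (Fin n) ℝ).PosSemidef := by
  rw [Matrix.posSemidef_iff_dotProduct_mulVec]
  refine ⟨A.2, fun x => ?_⟩
  have := h (WithLp.toLp 2 x)
  simpa [symQuad, dotProduct, Matrix.mulVec, Finset.mul_sum, mul_assoc] using this

lemma symQuad_add (A B : SymMat n) (v : EucSp n) :
    symQuad (A + B) v = symQuad A v + symQuad B v := by
  simp [symQuad, mul_add, add_mul, Finset.sum_add_distrib]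

lemma symQuad_smul (c : ℝ) (A : SymMat n) (v : EucSp n) :
    symQuad (c • A) v = c * symQuad A v := by
  simp only [symQuad, Finset.mul_sum]
  refine Finset.sum_congr rfl fun i _ => Finset.sum_congr rfl fun j _ => ?_
  have : (c • A).1 i j = c * A.1 i j := rfl
  rw [this]; ring

lemma symQuad_neg (A : SymMat n) (v : EucSp n) : symQuad (-A) v = -symQuad A v := by
  simp [symQuad]

lemma symQuad_sub (A B : SymMat n) (v : EucSp n) :
    symQuad (A - B) v = symQuad A v - symQuad B v := by
  rw [sub_eq_add_neg, symQuad_add, symQuad_neg, sub_eq_add_neg]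

lemma symQuad_one (v : EucSp n) : symQuad (1 : SymMat n) v = ‖v‖ ^ 2 := by
  rw [EuclideanSpace.norm_sq_eq]
  simp only [symQuad]
  refine Finset.sum_congr rfl fun i _ => ?_
  rw [Finset.sum_eq_single i]
  · have : (1 : SymMat n).1 i i = 1 := Matrix.one_apply_eq i
    rw [this]; simp [sq]
  · intro j _ hj
    have : (1 : SymMat n).1 i j = 0 := Matrix.one_apply_ne hj.symm
    rw [this]; ring
  · simp

lemma abs_symQuad_le (A : SymMat n) (v : EucSp n) :
    |symQuad A v| ≤ (∑ i, ∑ j, |A.1 i j|) * ‖v‖ ^ 2 := by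
  simp only [symQuad, Finset.sum_mul]
  refine (Finset.abs_sum_le_sum_abs _ _).trans (Finset.sum_le_sum fun i _ => ?_)
  refine (Finset.abs_sum_le_sum_abs _ _).trans (Finset.sum_le_sum fun j _ => ?_)
  have hi : |v i| ≤ ‖v‖ := PiLp.norm_apply_le v i
  have hj : |v j| ≤ ‖v‖ := PiLp.norm_apply_le v j
  rw [abs_mul, abs_mul]
  calc |v i| * |A.1 i j| * |v j| = |A.1 i j| * (|v i| * |v j|) := by ring
    _ ≤ |A.1 i j| * (‖v‖ * ‖v‖) := by gcongr
    _ = _ := by ring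

lemma continuous_symMat_entry (i j : Fin n) : Continuous fun A : SymMat n => A.1 i j :=
  (continuous_apply j).comp ((continuous_apply i).comp continuous_subtype_val)

lemma eventually_symPSD_add {δ : ℝ} (hδ : 0 < δ) :
    ∀ᶠ A in 𝓝 (0 : SymMat n), SymPSD (A + δ • (1 : SymMat n)) := by
  have hc : Continuous fun A : SymMat n => ∑ i, ∑ j, |A.1 i j| :=
    continuous_finsetSum _ fun i _ => continuous_finsetSum _ fun j _ =>
      (continuous_symMat_entry i j).abs
  have h0 : (∑ i, ∑ j, |(0 : SymMat n).1 i j|) < δ := by simpa using hδ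
  filter_upwards [hc.continuousAt.eventually_lt continuousAt_const h0] with A hA v
  rw [symQuad_add, symQuad_smul, symQuad_one]
  have h1 := abs_le.1 (abs_symQuad_le A v)
  nlinarith [h1.1, sq_nonneg ‖v‖]

lemma exists_symPSD_add (A : SymMat n) : ∃ C : ℝ, 0 ≤ C ∧ ∀ c ≥ C, SymPSD (A + c • (1 : SymMat n)) := by
  refine ⟨∑ i, ∑ j, |A.1 i j|, by positivity, fun c hc v => ?_⟩
  rw [symQuad_add, symQuad_smul, symQuad_one]
  have h1 := abs_le.1 (abs_symQuad_le A v)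
  nlinarith [h1.1, sq_nonneg ‖v‖]

lemma symPSD_one : SymPSD (1 : SymMat n) := fun v => by rw [symQuad_one]; positivity

lemma SymPSD.smul {A : SymMat n} (h : SymPSD A) {c : ℝ} (hc : 0 ≤ c) : SymPSD (c • A) :=
  fun v => by rw [symQuad_smul]; exact mul_nonneg hc (h v)

namespace ConeSubequation

lemma dim_pos (F : ConeSubequation n) : 0 < n := by
  rcases Nat.eq_zero_or_pos n with rfl | h
  · exfalso
    apply F.proper'
    obtain ⟨A, hA⟩ := F.nonempty'
    refine Set.eq_univ_of_forall fun B => ?_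
    have : B = A := Subtype.ext (by ext i; exact i.elim0)
    exact this ▸ hA
  · exact h

variable {F : ConeSubequation n}

lemma add_psd_mem {A P : SymMat n} (hA : A ∈ F.carrier) (hP : SymPSD P) : A + P ∈ F.carrier :=
  F.f1 A hA P hP.posSemidef

lemma zero_mem : (0 : SymMat n) ∈ F.carrier := by
  obtain ⟨A, hA⟩ := F.nonempty'
  have h1 : Tendsto (fun t : ℝ => t • A) (𝓝[>] 0) (𝓝 ((0 : ℝ) • A)) :=
    ((continuous_id.smul continuous_const).tendsto 0).mono_left nhdsWithin_le_nhds
  rw [zero_smul] at h1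
  refine F.isClosed'.mem_of_tendsto h1 ?_
  filter_upwards [self_mem_nhdsWithin] with t ht using F.f2 A hA t ht

lemma psd_mem {P : SymMat n} (hP : SymPSD P) : P ∈ F.carrier := by
  simpa using add_psd_mem zero_mem hP

lemma smul_mem {A : SymMat n} (hA : A ∈ F.carrier) {t : ℝ} (ht : 0 ≤ t) : t • A ∈ F.carrier := by
  rcases ht.eq_or_lt with rfl | h
  · rw [zero_smul]; exact zero_mem
  · exact F.f2 A hA t h

lemma add_mem (hF : Convex ℝ F.carrier) {A B : SymMat n} (hA : A ∈ F.carrier)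
    (hB : B ∈ F.carrier) : A + B ∈ F.carrier := by
  have h := hF hA hB (by norm_num : (0 : ℝ) ≤ 1 / 2) (by norm_num : (0 : ℝ) ≤ 1 / 2) (by norm_num)
  have := F.f2 _ h 2 (by norm_num)
  rw [← smul_add, smul_smul] at this
  norm_num at this
  exact this

lemma add_smul_one_mem_interior {A : SymMat n} (hA : A ∈ F.carrier) {δ : ℝ} (hδ : 0 < δ) :
    A + δ • (1 : SymMat n) ∈ interior F.carrier := by
  rw [mem_interior_iff_mem_nhds]
  have h : Tendsto (fun B : SymMat n => B - (A + δ • (1 : SymMat n)))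
      (𝓝 (A + δ • (1 : SymMat n))) (𝓝 0) := by
    have : Continuous fun B : SymMat n => B - (A + δ • (1 : SymMat n)) := by fun_prop
    simpa using this.tendsto (A + δ • (1 : SymMat n))
  filter_upwards [h.eventually (eventually_symPSD_add hδ)] with B hB
  have := add_psd_mem hA hB
  convert this using 1
  abel

lemma interior_add_psd {A P : SymMat n} (hA : A ∈ interior F.carrier) (hP : SymPSD P) :
    A + P ∈ interior F.carrier := by
  rw [mem_interior_iff_mem_nhds] at hA ⊢
  have h : Tendsto (fun B : SymMat n => B - P) (𝓝 (A + P)) (𝓝 A) := by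
    have : Continuous fun B : SymMat n => B - P := by fun_prop
    simpa using this.tendsto (A + P)
  filter_upwards [h.eventually hA] with B hB
  have := add_psd_mem hB hP
  rwa [sub_add_cancel] at this

lemma interior_smul {A : SymMat n} (hA : A ∈ interior F.carrier) {t : ℝ} (ht : 0 < t) :
    t • A ∈ interior F.carrier := by
  rw [mem_interior_iff_mem_nhds] at hA ⊢
  have h : Tendsto (fun B : SymMat n => t⁻¹ • B) (𝓝 (t • A)) (𝓝 A) := by
    have : Continuous fun B : SymMat n => t⁻¹ • B := by fun_prop
    have h2 := this.tendsto (t • A)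
    rwa [smul_smul, inv_mul_cancel₀ ht.ne', one_smul] at h2
  filter_upwards [h.eventually hA] with B hB
  have := F.f2 _ hB t ht
  rwa [smul_smul, mul_inv_cancel₀ ht.ne', one_smul] at this

lemma zero_notMem_interior : (0 : SymMat n) ∉ interior F.carrier := by
  intro h
  apply F.proper'
  refine Set.eq_univ_of_forall fun A => ?_
  rw [mem_interior_iff_mem_nhds] at h
  have h1 : Tendsto (fun t : ℝ => t • A) (𝓝[>] 0) (𝓝 ((0 : ℝ) • A)) :=
    ((continuous_id.smul continuous_const).tendsto 0).mono_left nhdsWithin_le_nhds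
  rw [zero_smul] at h1
  obtain ⟨t, ht, ht0⟩ := ((h1.eventually h).and self_mem_nhdsWithin).exists
  have ht0 : 0 < t := ht0
  have := F.f2 _ ht t⁻¹ (inv_pos.2 ht0)
  rwa [smul_smul, inv_mul_cancel₀ ht0.ne', one_smul] at this

lemma exists_sub_smul_one_mem {A : SymMat n} (hA : A ∈ interior F.carrier) :
    ∃ δ : ℝ, 0 < δ ∧ A - δ • (1 : SymMat n) ∈ interior F.carrier := by
  have h1 : Tendsto (fun t : ℝ => A - t • (1 : SymMat n)) (𝓝[>] 0) (𝓝 (A - (0 : ℝ) • (1 : SymMat n))) := by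
    have : Continuous fun t : ℝ => A - t • (1 : SymMat n) := by fun_prop
    exact (this.tendsto 0).mono_left nhdsWithin_le_nhds
  rw [zero_smul, sub_zero] at h1
  obtain ⟨t, ht, ht0⟩ := ((h1.eventually (isOpen_interior.mem_nhds hA)).and self_mem_nhdsWithin).exists
  exact ⟨t, ht0, ht⟩

lemma subset_dualSet (hF : Convex ℝ F.carrier) : F.carrier ⊆ dualSet F.carrier := by
  intro A hA hn
  apply zero_notMem_interior (F := F)
  rw [mem_interior_iff_mem_nhds] at hn ⊢
  have h : Tendsto (fun B : SymMat n => B - A) (𝓝 0) (𝓝 (-A)) := by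
    have : Continuous fun B : SymMat n => B - A := by fun_prop
    simpa using this.tendsto 0
  filter_upwards [h.eventually hn] with B hB
  have := add_mem hF hB hA
  rwa [sub_add_cancel] at this

variable (F) in
lemma isClosed_dualSet : IsClosed (dualSet F.carrier) := by
  have : dualSet F.carrier = (fun A : SymMat n => -A) ⁻¹' (interior F.carrier)ᶜ := rfl
  rw [this]
  exact isOpen_interior.isClosed_compl.preimage continuous_neg

lemma dualSet_smul_mem {A : SymMat n} (hA : A ∈ dualSet F.carrier) {t : ℝ} (ht : 0 < t) :
    t • A ∈ dualSet F.carrier := by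
  intro h
  apply hA
  have := interior_smul h (inv_pos.2 ht)
  rwa [smul_neg, smul_smul, inv_mul_cancel₀ ht.ne', one_smul] at this

/-- The bipolar theorem for a convex cone subequation. -/
lemma mem_of_forall_functional (hF : Convex ℝ F.carrier) {A : SymMat n}
    (h : ∀ ℓ : SymMat n →ₗ[ℝ] ℝ, Continuous ℓ → (∀ B ∈ F.carrier, 0 ≤ ℓ B) → 0 < ℓ 1 → 0 ≤ ℓ A) :
    A ∈ F.carrier := by
  by_contra hA
  let C : ProperCone ℝ (SymMat n) :=
    { carrier := F.carrier
      add_mem' := fun ha hb => add_mem hF ha hb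
      zero_mem' := zero_mem
      smul_mem' := fun c _ hx => smul_mem hx c.2
      isClosed' := F.isClosed' }
  obtain ⟨f, hf, hfA⟩ := C.hyperplane_separation_point (x₀ := A) hA
  have hf' : ∀ B ∈ F.carrier, 0 ≤ f B := hf
  obtain ⟨c, hc0, hc⟩ := exists_symPSD_add A
  have h1 : 0 ≤ f (A + c • (1 : SymMat n)) := hf' _ (psd_mem (hc c le_rfl))
  rw [map_add, map_smul, smul_eq_mul] at h1
  have h2 : 0 ≤ f 1 := hf' _ (psd_mem symPSD_one)
  have h3 : 0 < f 1 := by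
    rcases h2.eq_or_lt with h | h
    · rw [← h] at h1; linarith
    · exact h
  exact absurd (h f.toLinearMap f.continuous hf' h3) (not_le.2 hfA)

end ConeSubequation

/-- The second derivative of a function, as a bilinear map. -/
def secDeriv (f : EucSp n → ℝ) (x : EucSp n) : EucSp n →L[ℝ] EucSp n →L[ℝ] ℝ :=
  fderiv ℝ (fderiv ℝ f) x

/-- The standard basis vector. -/
abbrev stdVec (i : Fin n) : EucSp n := EuclideanSpace.single i 1

lemma sum_smul_stdVec (v : EucSp n) : ∑ i, v i • stdVec i = v := by
  ext j
  simp [Pi.single_apply]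

/-- The (symmetrized) Hessian as a symmetric matrix. -/
def symHess (f : EucSp n → ℝ) (x : EucSp n) : SymMat n :=
  ⟨Matrix.of fun i j =>
    (secDeriv f x (stdVec i) (stdVec j) + secDeriv f x (stdVec j) (stdVec i)) / 2, by
    rw [selfAdjoint.mem_iff]
    ext i j
    simp [Matrix.star_apply, add_comm]⟩

lemma symHess_apply (f : EucSp n → ℝ) (x : EucSp n) (i j : Fin n) :
    (symHess f x).1 i j =
      (secDeriv f x (stdVec i) (stdVec j) + secDeriv f x (stdVec j) (stdVec i)) / 2 := rfl

lemma bilin_expand (B : EucSp n →L[ℝ] EucSp n →L[ℝ] ℝ) (v w : EucSp n) :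
    B v w = ∑ i, ∑ j, v i * B (stdVec i) (stdVec j) * w j := by
  conv_lhs => rw [← sum_smul_stdVec v, ← sum_smul_stdVec w]
  simp only [map_sum, map_smul, sum_apply, smul_apply,
    smul_eq_mul, Finset.mul_sum]
  rw [Finset.sum_comm]
  refine Finset.sum_congr rfl fun i _ => Finset.sum_congr rfl fun j _ => ?_
  ring

lemma symQuad_symHess (f : EucSp n → ℝ) (x v : EucSp n) :
    symQuad (symHess f x) v = secDeriv f x v v := by
  have h1 := bilin_expand (secDeriv f x) v v
  have h2 : secDeriv f x v v = ∑ i, ∑ j, v i * secDeriv f x (stdVec j) (stdVec i) * v j := by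
    rw [h1, Finset.sum_comm]
    refine Finset.sum_congr rfl fun i _ => Finset.sum_congr rfl fun j _ => ?_
    ring
  have : secDeriv f x v v = (secDeriv f x v v + secDeriv f x v v) / 2 := by ring
  rw [this]
  nth_rewrite 1 [h1]
  rw [h2, ← Finset.sum_add_distrib, Finset.sum_div]
  refine Finset.sum_congr rfl fun i _ => ?_
  rw [← Finset.sum_add_distrib, Finset.sum_div]
  refine Finset.sum_congr rfl fun j _ => ?_
  rw [symHess_apply]; ring

lemma hessMatrix_eq_symHess {f : EucSp n → ℝ} {x : EucSp n} (hf : ContDiffAt ℝ 2 f x) :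
    hessMatrix f x = (symHess f x).1 := by
  have hs : IsSymmSndFDerivAt ℝ f x := hf.isSymmSndFDerivAt (by simp)
  ext i j
  have h1 : secDeriv f x (stdVec j) (stdVec i) = secDeriv f x (stdVec i) (stdVec j) :=
    hs.eq _ _
  rw [symHess_apply, h1]
  simp only [hessMatrix, Matrix.of_apply, iteratedFDeriv_two_apply]
  simp [secDeriv]

lemma hessMatrix_mem_iff {f : EucSp n → ℝ} {x : EucSp n} (hf : ContDiffAt ℝ 2 f x)
    (S : Set (SymMat n)) : hessMatrix f x ∈ Subtype.val '' S ↔ symHess f x ∈ S := by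
  rw [hessMatrix_eq_symHess hf]
  constructor
  · rintro ⟨A, hA, h⟩
    rwa [← Subtype.ext h]
  · exact fun h => ⟨_, h, rfl⟩

lemma symHess_congr_secDeriv {f g : EucSp n → ℝ} {x : EucSp n} {c : ℝ}
    {f' : EucSp n → ℝ} {x' : EucSp n}
    (h : secDeriv f x = secDeriv g x + c • secDeriv f' x') :
    symHess f x = symHess g x + c • symHess f' x' := by
  apply Subtype.ext
  ext i j
  have h1 : (symHess g x + c • symHess f' x').1 i j =
    (symHess g x).1 i j + c * (symHess f' x').1 i j := rfl
  rw [h1, symHess_apply, symHess_apply, symHess_apply, h]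
  simp only [add_apply, smul_apply, smul_eq_mul]
  ring

lemma eventually_differentiableAt {f : EucSp n → ℝ} {x : EucSp n} (hf : ContDiffAt ℝ 2 f x) :
    ∀ᶠ y in 𝓝 x, DifferentiableAt ℝ f y :=
  (hf.eventually (by simp)).mono fun _ h => h.differentiableAt (by norm_num)

lemma differentiableAt_fderiv {f : EucSp n → ℝ} {x : EucSp n} (hf : ContDiffAt ℝ 2 f x) :
    DifferentiableAt ℝ (fderiv ℝ f) x :=
  (hf.fderiv_right (m := 1) (by norm_num)).differentiableAt (by norm_num)

lemma symHess_add_smul {f g : EucSp n → ℝ} {x : EucSp n} (hf : ContDiffAt ℝ 2 f x)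
    (hg : ContDiffAt ℝ 2 g x) (c : ℝ) :
    symHess (fun y => f y + c * g y) x = symHess f x + c • symHess g x := by
  apply symHess_congr_secDeriv
  have h : fderiv ℝ (fun y => f y + c * g y) =ᶠ[𝓝 x]
      fun y => fderiv ℝ f y + c • fderiv ℝ g y := by
    filter_upwards [eventually_differentiableAt hf, eventually_differentiableAt hg] with y h1 h2
    rw [fderiv_fun_add h1 (h2.const_mul c), fderiv_const_mul h2 c]
  rw [secDeriv, h.fderiv_eq]
  exact ((differentiableAt_fderiv hf).hasFDerivAt.add
    ((differentiableAt_fderiv hg).hasFDerivAt.const_smul c)).fderiv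

lemma symHess_const (c : ℝ) (x : EucSp n) : symHess (fun _ => c) x = 0 := by
  apply Subtype.ext
  ext i j
  have h : secDeriv (fun _ : EucSp n => c) x = 0 := by
    have : fderiv ℝ (fun _ : EucSp n => c) = fun _ => 0 := by ext1 y; simp
    rw [secDeriv, this]; simp
  rw [symHess_apply, h]
  simp

lemma symHess_add {f g : EucSp n → ℝ} {x : EucSp n} (hf : ContDiffAt ℝ 2 f x)
    (hg : ContDiffAt ℝ 2 g x) :
    symHess (fun y => f y + g y) x = symHess f x + symHess g x := by
  simpa using symHess_add_smul hf hg 1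

lemma symHess_sub {f g : EucSp n → ℝ} {x : EucSp n} (hf : ContDiffAt ℝ 2 f x)
    (hg : ContDiffAt ℝ 2 g x) :
    symHess (fun y => f y - g y) x = symHess f x - symHess g x := by
  simpa [← sub_eq_add_neg] using symHess_add_smul hf hg (-1)

lemma symHess_const_mul {f : EucSp n → ℝ} {x : EucSp n} (hf : ContDiffAt ℝ 2 f x) (c : ℝ) :
    symHess (fun y => c * f y) x = c • symHess f x := by
  have := symHess_add_smul (f := fun _ => (0 : ℝ)) contDiffAt_const hf c
  simpa [symHess_const] using this

lemma symHess_neg {f : EucSp n → ℝ} {x : EucSp n} (hf : ContDiffAt ℝ 2 f x) :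
    symHess (fun y => - f y) x = - symHess f x := by
  simpa using symHess_const_mul hf (-1)

lemma symHess_add_const {f : EucSp n → ℝ} {x : EucSp n} (hf : ContDiffAt ℝ 2 f x) (c : ℝ) :
    symHess (fun y => f y + c) x = symHess f x := by
  simpa [symHess_const] using symHess_add hf (contDiffAt_const (c := c))

lemma hasFDerivAt_affine (a : EucSp n) (r : ℝ) (y : EucSp n) :
    HasFDerivAt (fun y : EucSp n => a + r • y) (r • ContinuousLinearMap.id ℝ (EucSp n)) y :=
  ((hasFDerivAt_id y).const_smul r).const_add a

lemma contDiffAt_comp_affine {f : EucSp n → ℝ} {a y : EucSp n} {r : ℝ}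
    (hf : ContDiffAt ℝ 2 f (a + r • y)) : ContDiffAt ℝ 2 (fun y => f (a + r • y)) y :=
  ContDiffAt.comp y hf (by fun_prop)

lemma symHess_comp_affine {f : EucSp n → ℝ} {a y : EucSp n} {r : ℝ}
    (hf : ContDiffAt ℝ 2 f (a + r • y)) :
    symHess (fun y => f (a + r • y)) y = (r ^ 2) • symHess f (a + r • y) := by
  have hc : Tendsto (fun y : EucSp n => a + r • y) (𝓝 y) (𝓝 (a + r • y)) :=
    (hasFDerivAt_affine a r y).continuousAt
  have h : fderiv ℝ (fun y => f (a + r • y)) =ᶠ[𝓝 y]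
      fun y => r • fderiv ℝ f (a + r • y) := by
    filter_upwards [hc.eventually (eventually_differentiableAt hf)] with z hz
    have := (hz.hasFDerivAt.comp z (hasFDerivAt_affine a r z)).fderiv
    rw [show (fun y => f (a + r • y)) = f ∘ (fun y => a + r • y) from rfl, this]
    ext v; simp
  have h2 := ((differentiableAt_fderiv hf).hasFDerivAt.comp y (hasFDerivAt_affine a r y)).const_smul r
  have h3 : secDeriv (fun y => f (a + r • y)) y = (r ^ 2) • secDeriv f (a + r • y) := by
    rw [secDeriv, h.fderiv_eq]
    refine h2.fderiv.trans ?_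
    ext v w
    simp [secDeriv, sq, mul_assoc]
  apply Subtype.ext
  ext i j
  have h4 : ((r ^ 2) • symHess f (a + r • y)).1 i j = r ^ 2 * (symHess f (a + r • y)).1 i j := rfl
  rw [h4, symHess_apply, symHess_apply, h3]
  simp only [smul_apply, smul_eq_mul]
  ring

lemma continuousAt_symHess {f : EucSp n → ℝ} {x : EucSp n} (hf : ContDiffAt ℝ 2 f x) :
    ContinuousAt (symHess f) x := by
  have h1 : ContinuousAt (secDeriv f) x :=
    ((hf.fderiv_right (m := 1) (by norm_num)).fderiv_right (m := 0) (by norm_num)).continuousAt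
  have h2 : ∀ i j : Fin n, ContinuousAt (fun y => secDeriv f y (stdVec i) (stdVec j)) x :=
    fun i j => (h1.clm_apply continuousAt_const).clm_apply continuousAt_const
  rw [Topology.IsInducing.subtypeVal.continuousAt_iff]
  refine continuousAt_pi.2 fun i => continuousAt_pi.2 fun j => ?_
  exact ((h2 i j).add (h2 j i)).div_const 2

lemma symHess_norm_sub_sq (z x : EucSp n) :
    symHess (fun y => ‖y - z‖ ^ 2) x = (2 : ℝ) • (1 : SymMat n) := by
  have h1 : fderiv ℝ (fun y : EucSp n => ‖y - z‖ ^ 2) =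
      fun y => (2 : ℝ) • (innerSL ℝ (y - z)) := by
    ext1 y
    have := ((hasFDerivAt_id y).sub_const z).norm_sq
    rw [show (fun y : EucSp n => ‖y - z‖ ^ 2) = fun y => ‖id y - z‖ ^ 2 from rfl, this.fderiv]
    ext w; simp
  have h2 : HasFDerivAt (fun y : EucSp n => (2 : ℝ) • (innerSL ℝ (y - z)))
      ((2 : ℝ) • (innerSL ℝ : EucSp n →L[ℝ] EucSp n →L[ℝ] ℝ)) x := by
    have := ((innerSL ℝ : EucSp n →L[ℝ] EucSp n →L[ℝ] ℝ).hasFDerivAt (x := x - z)).comp x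
      ((hasFDerivAt_id x).sub_const z)
    exact (this.const_smul (2 : ℝ))
  have h3 : secDeriv (fun y : EucSp n => ‖y - z‖ ^ 2) x = (2 : ℝ) • innerSL ℝ := by
    rw [secDeriv, h1, h2.fderiv]
  apply Subtype.ext
  ext i j
  have h4 : ((2 : ℝ) • (1 : SymMat n)).1 i j = 2 * (1 : Matrix (Fin n) (Fin n) ℝ) i j := rfl
  have h5 : ∀ i j : Fin n, (innerSL ℝ) (stdVec i) (stdVec j) = if i = j then (1 : ℝ) else 0 := by
    intro i j
    rw [innerSL_apply_apply, EuclideanSpace.inner_single_left]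
    simp
  rw [symHess_apply, h3, h4, Matrix.one_apply]
  simp only [smul_apply, smul_eq_mul, h5]
  rcases eq_or_ne i j with rfl | hij
  · simp
  · simp [hij, hij.symm]

lemma contDiff_norm_sub_sq (z : EucSp n) : ContDiff ℝ 2 (fun y : EucSp n => ‖y - z‖ ^ 2) :=
  (contDiff_id.sub contDiff_const).norm_sq ℝ

lemma deriv_deriv_nonneg_of_isLocalMin {g : ℝ → ℝ} {t : ℝ} (hg : ContinuousAt g t)
    (hmin : IsLocalMin g t) : 0 ≤ deriv (deriv g) t := by
  by_contra! hneg
  have hmax := isLocalMax_of_deriv_deriv_neg hneg hmin.deriv_eq_zero hg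
  have hc : g =ᶠ[𝓝 t] fun _ => g t := by
    filter_upwards [hmin, hmax] with y h1 h2 using le_antisymm h2 h1
  have h2 : deriv g =ᶠ[𝓝 t] fun _ => 0 := by
    have := hc.deriv
    simpa using this
  rw [h2.deriv_eq] at hneg
  simp at hneg

lemma symPSD_symHess_of_isLocalMin {f : EucSp n → ℝ} {x : EucSp n} (hf : ContDiffAt ℝ 2 f x)
    (hmin : IsLocalMin f x) : SymPSD (symHess f x) := by
  intro v
  rw [symQuad_symHess]
  have hline : ∀ t : ℝ, HasDerivAt (fun t : ℝ => x + t • v) v t := fun t => by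
    simpa using ((hasDerivAt_id t).smul_const v).const_add x
  have hc : Tendsto (fun t : ℝ => x + t • v) (𝓝 0) (𝓝 x) := by
    have := (hline 0).continuousAt.tendsto
    simpa using this
  have h1 : deriv (fun t : ℝ => f (x + t • v)) =ᶠ[𝓝 0] fun t => fderiv ℝ f (x + t • v) v := by
    filter_upwards [hc.eventually (eventually_differentiableAt hf)] with t ht
    exact (ht.hasFDerivAt.comp_hasDerivAt t (hline t)).deriv
  have h2 : HasDerivAt (fun t : ℝ => fderiv ℝ f (x + t • v) v) (secDeriv f x v v) 0 := by
    have hd : HasFDerivAt (fderiv ℝ f) (secDeriv f x) (x + (0 : ℝ) • v) := by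
      rw [zero_smul, add_zero]; exact (differentiableAt_fderiv hf).hasFDerivAt
    have := hd.comp_hasDerivAt (0 : ℝ) (hline 0)
    have h3 := this.clm_apply (hasDerivAt_const (0 : ℝ) v)
    simpa using h3
  rw [← h2.deriv, ← h1.deriv_eq]
  apply deriv_deriv_nonneg_of_isLocalMin
  · refine ContinuousAt.comp (g := f) ?_ (hline 0).continuousAt
    simpa using hf.continuousAt
  · have : ∀ᶠ t in 𝓝 (0 : ℝ), f x ≤ f (x + t • v) := hc.eventually hmin
    simpa [IsLocalMin, IsMinFilter] using this

/-- Viscosity `S`-subharmonicity of a real-valued function on `X`, without semicontinuity. -/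
def ViscOn (S : Set (SymMat n)) (X : Set (EucSp n)) (u : EucSp n → ℝ) : Prop :=
  ∀ x ∈ X, ∀ ψ : EucSp n → ℝ, ContDiffAt ℝ 2 ψ x → (∀ᶠ y in 𝓝 x, u y ≤ ψ y) → u x = ψ x →
    symHess ψ x ∈ S

lemma FSubharmonicOn.viscOn {S : Set (SymMat n)} {X : Set (EucSp n)} {u : EucSp n → ℝ}
    (h : FSubharmonicOn S X (fun y => (u y : EReal))) : ViscOn S X u := by
  intro x hx ψ hψ hle heq
  rw [← hessMatrix_mem_iff hψ]
  refine h.2.2 x hx ψ ⟨hψ, ?_, by simp [heq]⟩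
  filter_upwards [mem_nhdsWithin_of_mem_nhds hle] with y hy
  exact EReal.coe_le_coe_iff.2 hy

lemma ViscOn.fsubharmonicOn {S : Set (SymMat n)} {X : Set (EucSp n)} {u : EucSp n → ℝ}
    (hX : IsOpen X) (h : ViscOn S X u) (hu : ContinuousOn u X) :
    FSubharmonicOn S X (fun y => (u y : EReal)) := by
  refine ⟨(continuous_coe_real_ereal.comp_continuousOn hu).upperSemicontinuousOn,
    fun x _ => EReal.coe_ne_top _, fun x hx ψ hψ => ?_⟩
  rw [hessMatrix_mem_iff hψ.1]
  refine h x hx ψ hψ.1 ?_ (EReal.coe_eq_coe_iff.1 hψ.2.2)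
  have := hψ.2.1
  rw [hX.nhdsWithin_eq hx] at this
  filter_upwards [this] with y hy using EReal.coe_le_coe_iff.1 hy

lemma FHarmonicOn.viscOn {F : ConeSubequation n} {X : Set (EucSp n)} {u : EucSp n → ℝ}
    (h : FHarmonicOn F X (fun y => (u y : EReal))) :
    ViscOn F.carrier X u ∧ ViscOn (dualSet F.carrier) X (fun y => -u y) := by
  refine ⟨h.1.viscOn, FSubharmonicOn.viscOn ?_⟩
  simpa using h.2

lemma fharmonicOn_of_viscOn {F : ConeSubequation n} {X : Set (EucSp n)} {u : EucSp n → ℝ}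
    (hX : IsOpen X) (hu : ContinuousOn u X) (h1 : ViscOn F.carrier X u)
    (h2 : ViscOn (dualSet F.carrier) X (fun y => -u y)) :
    FHarmonicOn F X (fun y => (u y : EReal)) := by
  refine ⟨h1.fsubharmonicOn hX hu, ?_⟩
  have := h2.fsubharmonicOn hX hu.neg
  simpa using this

namespace ViscOn

variable {S : Set (SymMat n)} {X V : Set (EucSp n)} {u v w : EucSp n → ℝ}

lemma mono (h : ViscOn S X u) (hV : V ⊆ X) : ViscOn S V u := fun x hx => h x (hV hx)

lemma mono_set {T : Set (SymMat n)} (h : ViscOn S X u) (hT : S ⊆ T) : ViscOn T X u :=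
  fun x hx ψ h1 h2 h3 => hT (h x hx ψ h1 h2 h3)

lemma congr (h : ViscOn S X u) (hX : IsOpen X) (huv : Set.EqOn u v X) : ViscOn S X v := by
  intro x hx ψ h1 h2 h3
  refine h x hx ψ h1 ?_ ((huv hx).trans h3)
  filter_upwards [h2, hX.mem_nhds hx] with y hy hyX
  rw [huv hyX]; exact hy

lemma of_contDiffAt (hS : ∀ A ∈ S, ∀ P, SymPSD P → A + P ∈ S)
    (hu : ∀ x ∈ X, ContDiffAt ℝ 2 u x) (hm : ∀ x ∈ X, symHess u x ∈ S) : ViscOn S X u := by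
  intro x hx ψ h1 h2 h3
  have hP : SymPSD (symHess (fun y => ψ y - u y) x) := by
    refine symPSD_symHess_of_isLocalMin (h1.sub (hu x hx)) ?_
    filter_upwards [h2] with y hy
    linarith
  rw [symHess_sub h1 (hu x hx)] at hP
  have := hS _ (hm x hx) _ hP
  rwa [add_sub_cancel] at this

lemma const_mul_add (h : ViscOn S X u) {c : ℝ} (hc : 0 < c) (hS : ∀ A ∈ S, c • A ∈ S) (a : ℝ) :
    ViscOn S X (fun x => c * u x + a) := by
  intro x hx ψ h1 h2 h3
  have hψ : ContDiffAt ℝ 2 (fun y => c⁻¹ * (ψ y + -a)) x :=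
    contDiffAt_const.mul (h1.add contDiffAt_const)
  have := h x hx (fun y => c⁻¹ * (ψ y + -a)) hψ
    (by
      filter_upwards [h2] with y hy
      rw [inv_mul_eq_div, le_div_iff₀ hc]; linarith)
    (by
      rw [← h3]; field_simp; ring)
  rw [symHess_const_mul (h1.add contDiffAt_const), symHess_add_const h1] at this
  have := hS _ this
  rwa [smul_smul, mul_inv_cancel₀ hc.ne', one_smul] at this

lemma add_const (h : ViscOn S X u) (a : ℝ) : ViscOn S X (fun x => u x + a) := by
  simpa using h.const_mul_add one_pos (by simp) a

lemma comp_add (h : ViscOn S X u) (y : EucSp n) :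
    ViscOn S {x | x + y ∈ X} (fun x => u (x + y)) := by
  intro x hx ψ h1 h2 h3
  have h1' : ContDiffAt ℝ 2 ψ (-y + (1 : ℝ) • (x + y)) := by simpa using h1
  have := h (x + y) hx (fun z => ψ (-y + (1 : ℝ) • z)) (contDiffAt_comp_affine h1') (by
    have hc : Tendsto (fun z => -y + (1 : ℝ) • z) (𝓝 (x + y)) (𝓝 x) := by
      have : Continuous fun z : EucSp n => -y + (1 : ℝ) • z := by fun_prop
      simpa using this.tendsto (x + y)
    filter_upwards [hc.eventually h2] with z hz
    simpa using hz) (by simpa using h3)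
  rw [symHess_comp_affine h1'] at this
  simpa using this

lemma add_contDiffAt {F : ConeSubequation n} (hF : Convex ℝ F.carrier)
    (h : ViscOn F.carrier X u) (hw : ∀ x ∈ X, ContDiffAt ℝ 2 w x)
    (hm : ∀ x ∈ X, symHess w x ∈ F.carrier) : ViscOn F.carrier X (fun x => w x + u x) := by
  intro x hx ψ h1 h2 h3
  have := h x hx (fun y => ψ y - w y) (h1.sub (hw x hx))
    (by filter_upwards [h2] with y hy; linarith) (by linarith)
  rw [symHess_sub h1 (hw x hx)] at this
  have := F.add_mem hF this (hm x hx)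
  rwa [sub_add_cancel] at this

/-- The function equal to `max u w` on `V` and to `u` elsewhere. -/
def _root_.glueMax (V : Set (EucSp n)) (u w : EucSp n → ℝ) : EucSp n → ℝ :=
  fun x => if x ∈ V then max (u x) (w x) else u x

lemma _root_.le_glueMax (V : Set (EucSp n)) (u w : EucSp n → ℝ) (x : EucSp n) :
    u x ≤ glueMax V u w x := by
  unfold glueMax; split_ifs
  · exact le_max_left _ _
  · exact le_rfl

lemma _root_.le_glueMax_of_mem {V : Set (EucSp n)} (u w : EucSp n → ℝ) {x : EucSp n} (hx : x ∈ V) :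
    w x ≤ glueMax V u w x := by
  rw [glueMax, if_pos hx]; exact le_max_right _ _

lemma glueMax (hV : IsOpen V) (hu : ViscOn S X u) (hw : ViscOn S V w) :
    ViscOn S X (glueMax V u w) := by
  intro x hx ψ h1 h2 h3
  by_cases h : u x = _root_.glueMax V u w x
  · refine hu x hx ψ h1 ?_ (h.trans h3)
    filter_upwards [h2] with y hy using (le_glueMax V u w y).trans hy
  · have hxV : x ∈ V := by
      by_contra hxV
      exact h (by rw [_root_.glueMax, if_neg hxV])
    have hwx : w x = _root_.glueMax V u w x := by
      rw [_root_.glueMax, if_pos hxV] at h ⊢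
      rcases max_choice (u x) (w x) with h' | h'
      · exact absurd h'.symm h
      · exact h'.symm
    refine hw x hxV ψ h1 ?_ (hwx.trans h3)
    filter_upwards [h2, hV.mem_nhds hxV] with y hy hyV using (le_glueMax_of_mem u w hyV).trans hy

lemma _root_.continuousOn_glueMax {C K : Set (EucSp n)} (hV : IsOpen V) (hu : ContinuousOn u C)
    (hw : ContinuousOn w (V ∩ C)) (hK : IsClosed K) (hKV : K ⊆ V)
    (hle : ∀ x ∈ V ∩ C, x ∉ K → w x ≤ u x) : ContinuousOn (_root_.glueMax V u w) C := by
  intro x hx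
  by_cases hxV : x ∈ V
  · have h1 : ContinuousWithinAt w C x := by
      have := hw x ⟨hxV, hx⟩
      rwa [ContinuousWithinAt, Set.inter_comm, nhdsWithin_inter_of_mem'] at this
      exact mem_nhdsWithin_of_mem_nhds (hV.mem_nhds hxV)
    have hmax : ContinuousWithinAt (fun y => max (u y) (w y)) C x := (hu x hx).max h1
    refine hmax.congr_of_eventuallyEq ?_ ?_
    · filter_upwards [mem_nhdsWithin_of_mem_nhds (hV.mem_nhds hxV)] with y hy
      rw [_root_.glueMax, if_pos hy]
    · rw [_root_.glueMax, if_pos hxV]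
  · refine (hu x hx).congr_of_eventuallyEq ?_ ?_
    · filter_upwards [mem_nhdsWithin_of_mem_nhds (hK.isOpen_compl.mem_nhds fun h => hxV (hKV h)),
        self_mem_nhdsWithin] with y hy hyC
      rw [_root_.glueMax]
      split_ifs with hyV
      · exact max_eq_left (hle y ⟨hyV, hyC⟩ hy)
      · rfl
    · rw [_root_.glueMax, if_neg hxV]

/-- Stability of viscosity subharmonicity under locally one-sided approximation. -/
lemma of_approx (hS : IsClosed S) (h : ∀ z ∈ X, ∃ r > 0, ∀ ε > 0, ∃ v : EucSp n → ℝ,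
      ContinuousOn v (Metric.closedBall z r) ∧ ViscOn S (Metric.ball z r) v ∧
      (∀ x ∈ Metric.closedBall z r, v x ≤ u x + ε) ∧ u z - ε ≤ v z) : ViscOn S X u := by
  intro z hz ψ h1 h2 h3
  by_contra hnS
  obtain ⟨δ, hδ0, hδ⟩ : ∃ δ : ℝ, 0 < δ ∧ symHess ψ z + (2 * δ) • (1 : SymMat n) ∉ S := by
    have hc : Tendsto (fun δ : ℝ => symHess ψ z + (2 * δ) • (1 : SymMat n)) (𝓝[>] 0)
        (𝓝 (symHess ψ z)) := by
      have : Continuous fun δ : ℝ => symHess ψ z + (2 * δ) • (1 : SymMat n) := by fun_prop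
      have := this.tendsto 0
      simp only [mul_zero, zero_smul, add_zero] at this
      exact this.mono_left nhdsWithin_le_nhds
    obtain ⟨δ, h1, h2⟩ := ((hc.eventually (hS.isOpen_compl.mem_nhds hnS)).and
      self_mem_nhdsWithin).exists
    exact ⟨δ, h2, h1⟩
  have hev : ∀ᶠ y in 𝓝 z, symHess ψ y + (2 * δ) • (1 : SymMat n) ∉ S := by
    have hc : ContinuousAt (fun y => symHess ψ y + (2 * δ) • (1 : SymMat n)) z :=
      (continuousAt_symHess h1).add continuousAt_const
    exact hc.eventually (hS.isOpen_compl.mem_nhds hδ)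
  obtain ⟨r, hr, hv⟩ := h z hz
  obtain ⟨ρ, hρ, hball⟩ := Metric.eventually_nhds_iff_ball.1
    ((hev.and h2).and (h1.eventually (by simp)))
  obtain ⟨r', hr'0, hr'r, hr'ρ⟩ : ∃ r' : ℝ, 0 < r' ∧ r' ≤ r ∧ r' < ρ :=
    ⟨min r (ρ / 2), by positivity, min_le_left _ _, (min_le_right _ _).trans_lt (by linarith)⟩
  obtain ⟨v, hvc, hvS, hvu, hvz⟩ := hv (δ * r' ^ 2 / 4) (by positivity)
  have hsub : Metric.closedBall z r' ⊆ Metric.ball z ρ := Metric.closedBall_subset_ball hr'ρ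
  have hfc : ContinuousOn (fun y => v y - (ψ y + δ * ‖y - z‖ ^ 2)) (Metric.closedBall z r') := by
    refine (hvc.mono (Metric.closedBall_subset_closedBall hr'r)).sub (ContinuousOn.add ?_ ?_)
    · exact fun y hy => (hball y (hsub hy)).2.continuousAt.continuousWithinAt
    · fun_prop
  obtain ⟨w, hw, hmax⟩ := (isCompact_closedBall z r').exists_isMaxOn
    ⟨z, Metric.mem_closedBall_self hr'0.le⟩ hfc
  have hz' := hmax (Metric.mem_closedBall_self hr'0.le)
  simp only [Set.mem_ofPred_eq, sub_self, norm_zero] at hz'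
  have hwb : w ∈ Metric.ball z r' := by
    by_contra hwb
    have hd : r' ≤ ‖w - z‖ := by simpa [dist_eq_norm] using hwb
    have h4 := hvu w (Metric.closedBall_subset_closedBall hr'r hw)
    have h5 := (hball w (hsub hw)).1.2
    have h6 : r' ^ 2 ≤ ‖w - z‖ ^ 2 := by gcongr
    have h7 : 0 < δ * r' ^ 2 := by positivity
    have h8 : δ * r' ^ 2 ≤ δ * ‖w - z‖ ^ 2 := by gcongr
    linarith
  have hψw := (hball w (hsub hw)).2
  have hqw : ContDiffAt ℝ 2 (fun y : EucSp n => ‖y - z‖ ^ 2) w := (contDiff_norm_sub_sq z).contDiffAt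
  have hmem := hvS w (Metric.ball_subset_ball hr'r hwb)
    (fun y => (ψ y + δ * ‖y - z‖ ^ 2) + (v w - (ψ w + δ * ‖w - z‖ ^ 2)))
    ((hψw.add (contDiffAt_const.mul hqw)).add contDiffAt_const)
    (by
      filter_upwards [Metric.isOpen_ball.mem_nhds hwb] with y hy
      have := hmax (Metric.ball_subset_closedBall hy)
      simp only [Set.mem_ofPred_eq] at this
      linarith) (by ring)
  rw [symHess_add_const (hψw.add (contDiffAt_const.mul hqw)), symHess_add_smul hψw hqw,
    symHess_norm_sub_sq, smul_smul, mul_comm δ 2] at hmem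
  exact (hball w (hsub hw)).1.1 hmem

end ViscOn

/-- The polynomial function on Euclidean space attached to a multivariate polynomial. -/
def polyFun (p : MvPolynomial (Fin n) ℝ) (x : EucSp n) : ℝ := MvPolynomial.eval (fun i => x i) p

lemma contDiff_polyFun {k : WithTop ℕ∞} (p : MvPolynomial (Fin n) ℝ) : ContDiff ℝ k (polyFun p) := by
  induction p using MvPolynomial.induction_on with
  | C a =>
    have : polyFun (MvPolynomial.C a : MvPolynomial (Fin n) ℝ) = fun _ => a := by
      ext x; simp [polyFun]
    rw [this]; exact contDiff_const
  | add p q hp hq =>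
    have : polyFun (p + q) = fun x => polyFun p x + polyFun q x := by
      ext x; simp [polyFun]
    rw [this]; exact hp.add hq
  | mul_X p i hp =>
    have : polyFun (p * MvPolynomial.X i) = fun x => polyFun p x * x i := by
      ext x; simp [polyFun]
    rw [this]
    exact hp.mul (EuclideanSpace.proj i : EucSp n →L[ℝ] ℝ).contDiff

lemma continuous_polyFun (p : MvPolynomial (Fin n) ℝ) : Continuous (polyFun p) :=
  (contDiff_polyFun (k := 0) p).continuous

lemma hasFDerivAt_polyFun (p : MvPolynomial (Fin n) ℝ) (x : EucSp n) :
    HasFDerivAt (polyFun p)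
      (∑ i, polyFun (MvPolynomial.pderiv i p) x • (EuclideanSpace.proj i : EucSp n →L[ℝ] ℝ)) x := by
  induction p using MvPolynomial.induction_on with
  | C a =>
    have : polyFun (MvPolynomial.C a : MvPolynomial (Fin n) ℝ) = fun _ => a := by
      ext x; simp [polyFun]
    rw [this]
    simpa [polyFun, MvPolynomial.pderiv_C] using hasFDerivAt_const a x
  | add p q hp hq =>
    have : polyFun (p + q) = fun x => polyFun p x + polyFun q x := by
      ext x; simp [polyFun]
    rw [this]
    refine (hp.add hq).congr_fderiv ?_
    simp [polyFun, add_smul, Finset.sum_add_distrib]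
  | mul_X p i hp =>
    have : polyFun (p * MvPolynomial.X i) = fun x => polyFun p x * x i := by
      ext x; simp [polyFun]
    rw [this]
    have hi : HasFDerivAt (fun x : EucSp n => x i) (EuclideanSpace.proj i : EucSp n →L[ℝ] ℝ) x :=
      (EuclideanSpace.proj i : EucSp n →L[ℝ] ℝ).hasFDerivAt
    refine (hp.mul hi).congr_fderiv ?_
    ext v
    simp [polyFun, add_mul, Finset.sum_add_distrib, Finset.mul_sum, MvPolynomial.pderiv_X,
      Pi.single_apply, apply_ite]
    exact Finset.sum_congr rfl fun j _ => by ring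

lemma fderiv_polyFun_stdVec (p : MvPolynomial (Fin n) ℝ) (x : EucSp n) (i : Fin n) :
    fderiv ℝ (polyFun p) x (stdVec i) = polyFun (MvPolynomial.pderiv i p) x := by
  rw [(hasFDerivAt_polyFun p x).fderiv]
  simp [stdVec]

lemma secDeriv_polyFun_stdVec (p : MvPolynomial (Fin n) ℝ) (x : EucSp n) (i j : Fin n) :
    secDeriv (polyFun p) x (stdVec i) (stdVec j) =
      polyFun (MvPolynomial.pderiv i (MvPolynomial.pderiv j p)) x := by
  have hd := differentiableAt_fderiv (contDiff_polyFun (k := 2) p).contDiffAt (x := x)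
  have h1 : HasFDerivAt (fun y => fderiv ℝ (polyFun p) y (stdVec j))
      ((ContinuousLinearMap.apply ℝ ℝ (stdVec j)).comp (fderiv ℝ (fderiv ℝ (polyFun p)) x)) x :=
    (ContinuousLinearMap.apply ℝ ℝ (stdVec j : EucSp n)).hasFDerivAt.comp x hd.hasFDerivAt
  have h2 : (fun y => fderiv ℝ (polyFun p) y (stdVec j)) =
      polyFun (MvPolynomial.pderiv j p) := by
    ext y; exact fderiv_polyFun_stdVec p y j
  rw [h2] at h1
  rw [← fderiv_polyFun_stdVec, h1.fderiv]
  simp [secDeriv]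

/-- The constant coefficient second order operator on polynomials attached to a linear functional
on symmetric matrices. -/
def polyOp (ℓ : SymMat n →ₗ[ℝ] ℝ) : MvPolynomial (Fin n) ℝ →ₗ[ℝ] MvPolynomial (Fin n) ℝ :=
  ∑ i, ∑ j, (ℓ ⟨(2 : ℝ)⁻¹ • (Matrix.single i j 1 + Matrix.single j i 1), by
      rw [selfAdjoint.mem_iff]; simp [add_comm, Matrix.star_eq_conjTranspose]⟩) •
    ((MvPolynomial.pderiv i).toLinearMap ∘ₗ (MvPolynomial.pderiv j).toLinearMap)

lemma symMat_eq_sum (A : SymMat n) : A = ∑ i, ∑ j, A.1 i j •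
    (⟨(2 : ℝ)⁻¹ • (Matrix.single i j 1 + Matrix.single j i 1), by
      rw [selfAdjoint.mem_iff]; simp [add_comm, Matrix.star_eq_conjTranspose]⟩ : SymMat n) := by
  apply Subtype.ext
  have hA : ∀ i j, A.1 j i = A.1 i j := fun i j => by
    have := congrArg (fun B : Matrix (Fin n) (Fin n) ℝ => B i j) (selfAdjoint.mem_iff.1 A.2)
    simpa [Matrix.star_apply] using this
  have key : ∀ B : Matrix (Fin n) (Fin n) ℝ, B = ∑ i, ∑ j, B i j • Matrix.single i j (1 : ℝ) := by
    intro B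
    conv_lhs => rw [Matrix.matrix_eq_sum_single B]
    simp
  have key2 : A.1 = ∑ i, ∑ j, A.1 i j • Matrix.single j i (1 : ℝ) := by
    conv_lhs => rw [key A.1]
    rw [Finset.sum_comm]
    exact Finset.sum_congr rfl fun i _ => Finset.sum_congr rfl fun j _ => by rw [hA]
  have : ((∑ i, ∑ j, A.1 i j •
    (⟨(2 : ℝ)⁻¹ • (Matrix.single i j 1 + Matrix.single j i 1), by
      rw [selfAdjoint.mem_iff]; simp [add_comm, Matrix.star_eq_conjTranspose]⟩ : SymMat n) :
        SymMat n) : Matrix (Fin n) (Fin n) ℝ) =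
      ∑ i, ∑ j, A.1 i j • ((2 : ℝ)⁻¹ • (Matrix.single i j (1 : ℝ) + Matrix.single j i 1)) := by
    simp only [AddSubgroup.val_finsetSum, selfAdjoint.val_smul]
  rw [this]
  have : ∀ i j, A.1 i j • ((2 : ℝ)⁻¹ • (Matrix.single i j (1 : ℝ) + Matrix.single j i 1)) =
      (2 : ℝ)⁻¹ • (A.1 i j • Matrix.single i j (1 : ℝ)) +
      (2 : ℝ)⁻¹ • (A.1 i j • Matrix.single j i (1 : ℝ)) := by
    intro i j
    rw [smul_add, smul_add, smul_comm, smul_comm (A.1 i j) (2 : ℝ)⁻¹]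
  simp only [this, Finset.sum_add_distrib, ← Finset.smul_sum]
  rw [← key, ← key2, ← add_smul]
  norm_num

lemma polyFun_polyOp (ℓ : SymMat n →ₗ[ℝ] ℝ) (p : MvPolynomial (Fin n) ℝ) (x : EucSp n) :
    polyFun (polyOp ℓ p) x = ℓ (symHess (polyFun p) x) := by
  have hsymm : ∀ i j, (symHess (polyFun p) x).1 i j =
      polyFun (MvPolynomial.pderiv i (MvPolynomial.pderiv j p)) x := by
    intro i j
    have hs : IsSymmSndFDerivAt ℝ (polyFun p) x :=
      (contDiff_polyFun (k := 2) p).contDiffAt.isSymmSndFDerivAt (by simp)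
    have h1 : secDeriv (polyFun p) x (stdVec j) (stdVec i) =
      secDeriv (polyFun p) x (stdVec i) (stdVec j) := hs.eq _ _
    rw [symHess_apply, h1, secDeriv_polyFun_stdVec]
    ring
  rw [symMat_eq_sum (symHess (polyFun p) x)]
  simp only [map_sum, map_smul, hsymm]
  simp [polyOp, polyFun, LinearMap.sum_apply, mul_comm]

lemma totalDegree_pderiv_le_sub (i : Fin n) (p : MvPolynomial (Fin n) ℝ) {d : ℕ}
    (hp : p.totalDegree ≤ d + 1) : (MvPolynomial.pderiv i p).totalDegree ≤ d := by
  refine Finset.sup_le fun m hm => ?_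
  rw [MvPolynomial.mem_support_iff, MvPolynomial.coeff_pderiv] at hm
  have h1 := left_ne_zero_of_mul hm
  have h2 := (MvPolynomial.le_totalDegree (MvPolynomial.mem_support_iff.2 h1)).trans hp
  rw [Finsupp.sum_add_index' (by simp) (by simp)] at h2
  simp at h2
  exact h2

lemma totalDegree_polyOp_le (ℓ : SymMat n →ₗ[ℝ] ℝ) (p : MvPolynomial (Fin n) ℝ) {d : ℕ}
    (hp : p.totalDegree ≤ d + 2) : (polyOp ℓ p).totalDegree ≤ d := by
  simp only [polyOp, LinearMap.sum_apply]
  refine MvPolynomial.totalDegree_finsetSum_le fun i _ =>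
    MvPolynomial.totalDegree_finsetSum_le fun j _ => ?_
  refine (MvPolynomial.totalDegree_smul_le _ _).trans ?_
  exact totalDegree_pderiv_le_sub _ _ (totalDegree_pderiv_le_sub _ _ hp)

/-- Comparison of a viscosity subsolution with a smooth supersolution on a ball. -/
lemma ViscOn.le_of_le_sphere {ℓ : SymMat n →ₗ[ℝ] ℝ} (h1 : 0 < ℓ 1) {x : EucSp n} {r : ℝ}
    {u p : EucSp n → ℝ} (hu : ContinuousOn u (Metric.closedBall x r))
    (hv : ViscOn {A | 0 ≤ ℓ A} (Metric.ball x r) u) (hp : ContDiff ℝ 2 p)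
    (hpp : ∀ y ∈ Metric.ball x r, ℓ (symHess p y) ≤ 0) (hle : ∀ y ∈ Metric.sphere x r, u y ≤ p y) :
    ∀ y ∈ Metric.closedBall x r, u y ≤ p y := by
  intro y₀ hy₀
  by_contra! hlt
  obtain ⟨δ, hδ, hδr⟩ : ∃ δ : ℝ, 0 < δ ∧ δ * r ^ 2 < u y₀ - p y₀ := by
    refine ⟨(u y₀ - p y₀) / (2 * (r ^ 2 + 1)), by have := sub_pos.2 hlt; positivity, ?_⟩
    have := sub_pos.2 hlt
    rw [div_mul_eq_mul_div, div_lt_iff₀ (by positivity)]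
    nlinarith [sq_nonneg r]
  have hfc : ContinuousOn (fun y => u y - (p y - δ * ‖y - x‖ ^ 2)) (Metric.closedBall x r) := by
    have := hp.continuous
    refine hu.sub (Continuous.continuousOn ?_)
    fun_prop
  obtain ⟨w, hw, hmax⟩ := (isCompact_closedBall x r).exists_isMaxOn ⟨y₀, hy₀⟩ hfc
  have hm := hmax hy₀
  simp only [Set.mem_ofPred_eq] at hm
  have h0 : 0 ≤ δ * ‖y₀ - x‖ ^ 2 := by positivity
  have hwb : w ∈ Metric.ball x r := by
    by_contra hwb
    have hwr : ‖w - x‖ = r := by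
      rw [← dist_eq_norm]
      exact le_antisymm hw (not_lt.1 hwb)
    have := hle w (by simpa [dist_eq_norm] using hwr)
    rw [hwr] at hm
    linarith
  have hq : ContDiffAt ℝ 2 (fun y : EucSp n => ‖y - x‖ ^ 2) w := (contDiff_norm_sub_sq x).contDiffAt
  have hmem := hv w hwb
    (fun y => (p y + (-δ) * ‖y - x‖ ^ 2) + (u w - (p w - δ * ‖w - x‖ ^ 2)))
    ((hp.contDiffAt.add (contDiffAt_const.mul hq)).add contDiffAt_const)
    (by
      filter_upwards [Metric.isOpen_ball.mem_nhds hwb] with y hy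
      have := hmax (Metric.ball_subset_closedBall hy)
      simp only [Set.mem_ofPred_eq] at this
      linarith) (by ring)
  rw [symHess_add_const (hp.contDiffAt.add (contDiffAt_const.mul hq)),
    symHess_add_smul hp.contDiffAt hq, symHess_norm_sub_sq] at hmem
  have h3 : 0 ≤ ℓ (symHess p w + (-δ) • (2 : ℝ) • (1 : SymMat n)) := hmem
  rw [map_add, map_smul, map_smul, smul_eq_mul, smul_eq_mul] at h3
  have := hpp w hwb
  nlinarith

lemma halfspace_add_psd {ℓ : SymMat n →ₗ[ℝ] ℝ} (hP : ∀ A, SymPSD A → 0 ≤ ℓ A) :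
    ∀ A ∈ {A | 0 ≤ ℓ A}, ∀ P, SymPSD P → A + P ∈ {A | 0 ≤ ℓ A} := by
  intro A hA P hPP
  have hA' : 0 ≤ ℓ A := hA
  show 0 ≤ ℓ (A + P)
  rw [map_add]; exact add_nonneg hA' (hP P hPP)

lemma polyFun_abs_le_of_polyOp_eq_zero {ℓ : SymMat n →ₗ[ℝ] ℝ} (h1 : 0 < ℓ 1)
    (hP : ∀ A, SymPSD A → 0 ≤ ℓ A) {p : MvPolynomial (Fin n) ℝ} (hp : polyOp ℓ p = 0) {C : ℝ}
    (hC : ∀ y ∈ Metric.sphere (0 : EucSp n) 1, |polyFun p y| ≤ C) :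
    ∀ y ∈ Metric.closedBall (0 : EucSp n) 1, |polyFun p y| ≤ C := by
  have key : ∀ q : MvPolynomial (Fin n) ℝ, polyOp ℓ q = 0 →
      (∀ y ∈ Metric.sphere (0 : EucSp n) 1, polyFun q y ≤ C) →
      ∀ y ∈ Metric.closedBall (0 : EucSp n) 1, polyFun q y ≤ C := by
    intro q hq hqC
    refine ViscOn.le_of_le_sphere h1 (continuous_polyFun q).continuousOn
      (ViscOn.of_contDiffAt (halfspace_add_psd hP) (fun x _ => (contDiff_polyFun q).contDiffAt)
        fun x _ => ?_) (contDiff_const (c := C)) (fun y _ => by simp [symHess_const]) hqC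
    show 0 ≤ ℓ _
    rw [← polyFun_polyOp, hq]
    simp [polyFun]
  intro y hy
  rw [abs_le]
  constructor
  · have := key (-p) (by rw [map_neg, hp, neg_zero])
      (fun y hy => by have := neg_le_of_abs_le (hC y hy); simp only [polyFun, map_neg] at this ⊢; linarith)
      y hy
    simp only [polyFun, map_neg] at this ⊢; linarith
  · exact key p hp (fun y hy => le_of_abs_le (hC y hy)) y hy

lemma eq_zero_of_polyFun_eq_zero {p : MvPolynomial (Fin n) ℝ}
    (hp : ∀ y ∈ Metric.ball (0 : EucSp n) 1, polyFun p y = 0) : p = 0 := by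
  have hs : ∀ i : Fin n, (Set.Ioo (-1 / (n + 1) : ℝ) (1 / (n + 1))).Infinite := fun i =>
    Set.Ioo_infinite (by rw [div_lt_div_iff_of_pos_right (by positivity)]; norm_num)
  refine MvPolynomial.funext_set (fun _ => Set.Ioo (-1 / (n + 1) : ℝ) (1 / (n + 1))) hs
    fun x hx => ?_
  have := hp (WithLp.toLp 2 x) ?_
  · simpa [polyFun] using this
  rw [mem_ball_zero_iff]
  have h1 : ‖(WithLp.toLp 2 x : EucSp n)‖ ^ 2 < 1 := by
    rw [EuclideanSpace.norm_sq_eq]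
    calc ∑ i, ‖x i‖ ^ 2 ≤ ∑ _i : Fin n, (1 / (n + 1) : ℝ) := by
          refine Finset.sum_le_sum fun i _ => ?_
          have := hx i (Set.mem_univ i)
          have h2 : |x i| ≤ 1 / (n + 1) := abs_le.2 ⟨by rw [← neg_div]; exact this.1.le, this.2.le⟩
          have h3 : (1 / (n + 1) : ℝ) ≤ 1 := by
            rw [div_le_one (by positivity)]; linarith [(Nat.cast_nonneg n : (0 : ℝ) ≤ n)]
          rw [Real.norm_eq_abs]
          nlinarith [abs_nonneg (x i)]
      _ < 1 := by
          simp only [Finset.sum_const, Finset.card_univ, Fintype.card_fin, nsmul_eq_mul]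
          rw [mul_one_div, div_lt_one (by positivity)]; linarith
  exact (sq_lt_one_iff₀ (norm_nonneg _)).1 h1

/-- The polynomial `1 - |x|²`. -/
def spherePoly (n : ℕ) : MvPolynomial (Fin n) ℝ := 1 - ∑ i, MvPolynomial.X i ^ 2

lemma polyFun_spherePoly (x : EucSp n) : polyFun (spherePoly n) x = 1 - ‖x‖ ^ 2 := by
  rw [EuclideanSpace.norm_sq_eq]
  simp [polyFun, spherePoly]

lemma totalDegree_spherePoly_mul {q : MvPolynomial (Fin n) ℝ} {d : ℕ} (hq : q.totalDegree ≤ d) :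
    (spherePoly n * q).totalDegree ≤ d + 2 := by
  refine (MvPolynomial.totalDegree_mul _ _).trans ?_
  have : (spherePoly n).totalDegree ≤ 2 := by
    refine (MvPolynomial.totalDegree_sub _ _).trans (max_le (by simp) ?_)
    refine MvPolynomial.totalDegree_finsetSum_le fun i _ => ?_
    refine (MvPolynomial.totalDegree_pow _ _).trans ?_
    simp
  omega

/-- Every polynomial agrees on the unit sphere with a polynomial in the kernel of `polyOp ℓ`. -/
lemma exists_polyOp_eq_zero {ℓ : SymMat n →ₗ[ℝ] ℝ} (h1 : 0 < ℓ 1)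
    (hP : ∀ A, SymPSD A → 0 ≤ ℓ A) (p : MvPolynomial (Fin n) ℝ) :
    ∃ q, polyOp ℓ q = 0 ∧ ∀ y ∈ Metric.sphere (0 : EucSp n) 1, polyFun q y = polyFun p y := by
  set d := p.totalDegree
  have hsp : ∀ (q : MvPolynomial (Fin n) ℝ), ∀ y ∈ Metric.sphere (0 : EucSp n) 1,
      polyFun (spherePoly n * q) y = 0 := by
    intro q y hy
    have h2 := polyFun_spherePoly y
    rw [mem_sphere_zero_iff_norm.1 hy] at h2
    simp only [polyFun] at h2 ⊢
    rw [map_mul, h2]; norm_num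
  let T : MvPolynomial.restrictTotalDegree (Fin n) ℝ d →ₗ[ℝ]
      MvPolynomial.restrictTotalDegree (Fin n) ℝ d :=
    (polyOp ℓ ∘ₗ LinearMap.mulLeft ℝ (spherePoly n)).restrict (fun q hq => by
      rw [MvPolynomial.mem_restrictTotalDegree] at hq ⊢
      exact totalDegree_polyOp_le ℓ _ (totalDegree_spherePoly_mul hq))
  have hT : ∀ q, (T q).1 = polyOp ℓ (spherePoly n * q.1) := fun q => rfl
  have hinj : Function.Injective T := by
    rw [injective_iff_map_eq_zero]
    intro q hq
    have h0 : polyOp ℓ (spherePoly n * q.1) = 0 := by rw [← hT, hq]; rfl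
    have h2 := polyFun_abs_le_of_polyOp_eq_zero h1 hP h0 (C := 0)
      (fun y hy => by rw [hsp _ y hy, abs_zero])
    apply Subtype.ext
    refine eq_zero_of_polyFun_eq_zero fun y hy => ?_
    have h3 := abs_nonpos_iff.1 (h2 y (Metric.ball_subset_closedBall hy))
    have h4 := polyFun_spherePoly y
    rw [mem_ball_zero_iff] at hy
    simp only [polyFun, map_mul] at h3 h4 ⊢
    rw [h4] at h3
    refine (mul_eq_zero.1 h3).resolve_left ?_
    nlinarith [norm_nonneg y]
  obtain ⟨q, hq⟩ := (LinearMap.injective_iff_surjective.1 hinj)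
    ⟨polyOp ℓ p, by
      rw [MvPolynomial.mem_restrictTotalDegree]
      exact totalDegree_polyOp_le ℓ p (by omega)⟩
  refine ⟨p - spherePoly n * q.1, ?_, fun y hy => ?_⟩
  · rw [map_sub, ← hT, hq, sub_self]
  · have := hsp q.1 y hy
    simp only [polyFun, map_sub] at this ⊢
    rw [this, sub_zero]

lemma exists_polyFun_near {K : Set (EucSp n)} (hK : IsCompact K) {f : EucSp n → ℝ}
    (hf : ContinuousOn f K) {ε : ℝ} (hε : 0 < ε) :
    ∃ p : MvPolynomial (Fin n) ℝ, ∀ x ∈ K, |polyFun p x - f x| ≤ ε := by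
  have : CompactSpace K := isCompact_iff_compactSpace.1 hK
  let ρ : MvPolynomial (Fin n) ℝ →ₐ[ℝ] C(K, ℝ) :=
    MvPolynomial.aeval fun i => ⟨fun x : K => x.1 i, by fun_prop⟩
  have hρ : ∀ p (x : K), ρ p x = polyFun p x.1 := by
    intro p x
    induction p using MvPolynomial.induction_on with
    | C a => simp [ρ, polyFun]
    | add p q hp hq => simp [hp, hq, polyFun]
    | mul_X p i hp => simp [hp, polyFun]; left; simp [ρ]
  have hsep : ρ.range.SeparatesPoints := by
    intro x y hxy
    have : ∃ i, x.1 i ≠ y.1 i := by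
      by_contra! h
      exact hxy (Subtype.ext (by ext i; exact h i))
    obtain ⟨i, hi⟩ := this
    refine ⟨ρ (MvPolynomial.X i), ⟨_, ⟨_, rfl⟩, rfl⟩, ?_⟩
    rw [hρ, hρ]
    simpa [polyFun] using hi
  obtain ⟨⟨g, p, rfl⟩, hg⟩ := ContinuousMap.exists_mem_subalgebra_near_continuous_of_separatesPoints
    ρ.range hsep (fun x : K => f x.1) hf.domRestrict ε hε
  refine ⟨p, fun x hx => ?_⟩
  have := hg ⟨x, hx⟩
  simp only [Real.norm_eq_abs] at this
  have h2 := hρ p ⟨x, hx⟩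
  rw [← h2]
  exact this.le

/-- The restriction of polynomials to the unit sphere. -/
def spherePolyMap (n : ℕ) :
    MvPolynomial (Fin n) ℝ →ₗ[ℝ] C(Metric.sphere (0 : EucSp n) 1, ℝ) where
  toFun p := ⟨fun y => polyFun p y.1, (continuous_polyFun p).comp continuous_subtype_val⟩
  map_add' p q := by ext; simp [polyFun]
  map_smul' c p := by ext; simp [polyFun]

lemma spherePolyMap_apply (p : MvPolynomial (Fin n) ℝ) (y : Metric.sphere (0 : EucSp n) 1) :
    spherePolyMap n p y = polyFun p y.1 := rfl

/-- A functional representing `ℓ`-harmonic measure of the unit ball at its centre. -/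
lemma exists_sphere_functional {ℓ : SymMat n →ₗ[ℝ] ℝ} (h1 : 0 < ℓ 1)
    (hP : ∀ A, SymPSD A → 0 ≤ ℓ A) :
    ∃ L : C(Metric.sphere (0 : EucSp n) 1, ℝ) →L[ℝ] ℝ, ‖L‖ ≤ 1 ∧
      ∀ p, polyOp ℓ p = 0 → L (spherePolyMap n p) = polyFun p 0 := by
  have hbound : ∀ p, polyOp ℓ p = 0 → ∀ y ∈ Metric.closedBall (0 : EucSp n) 1,
      |polyFun p y| ≤ ‖spherePolyMap n p‖ := by
    intro p hp
    exact polyFun_abs_le_of_polyOp_eq_zero h1 hP hp fun y hy =>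
      (spherePolyMap n p).norm_coe_le_norm ⟨y, hy⟩
  let R : LinearMap.ker (polyOp ℓ) →ₗ[ℝ] C(Metric.sphere (0 : EucSp n) 1, ℝ) :=
    (spherePolyMap n).domRestrict _
  have hR : Function.Injective R := by
    rw [injective_iff_map_eq_zero]
    intro p hp
    apply Subtype.ext
    refine eq_zero_of_polyFun_eq_zero fun y hy => ?_
    have := hbound p.1 p.2 y (Metric.ball_subset_closedBall hy)
    have h0 : spherePolyMap n p.1 = 0 := hp
    rw [h0, norm_zero] at this
    exact abs_nonpos_iff.1 this
  let e := LinearEquiv.ofInjective R hR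
  let ev : LinearMap.ker (polyOp ℓ) →ₗ[ℝ] ℝ :=
    { toFun := fun p => polyFun p.1 0
      map_add' := fun p q => by simp [polyFun]
      map_smul' := fun c p => by simp [polyFun] }
  let f : StrongDual ℝ (LinearMap.range R) := (ev ∘ₗ e.symm.toLinearMap).mkContinuous 1 (by
    intro g
    obtain ⟨p, rfl⟩ := e.surjective g
    have := hbound p.1 p.2 0 (by simp)
    simp only [LinearMap.comp_apply, LinearEquiv.coe_coe, LinearEquiv.symm_apply_apply, one_mul]
    exact this)
  obtain ⟨L, hL, hLn⟩ := _root_.exists_extension_norm_eq (LinearMap.range R) f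
  refine ⟨L, hLn.le.trans (LinearMap.mkContinuous_norm_le _ zero_le_one _), fun p hp => ?_⟩
  have := hL (e ⟨p, hp⟩)
  have h2 : ((e ⟨p, hp⟩ : LinearMap.range R) : C(Metric.sphere (0 : EucSp n) 1, ℝ)) =
      spherePolyMap n p := rfl
  rw [h2] at this
  rw [this]
  show ev (e.symm (e ⟨p, hp⟩)) = _
  rw [LinearEquiv.symm_apply_apply]
  rfl

/-- `L` is a mean value functional for `ℓ`-subharmonic functions. -/
structure IsMeanValue (ℓ : SymMat n →ₗ[ℝ] ℝ)
    (L : C(Metric.sphere (0 : EucSp n) 1, ℝ) →L[ℝ] ℝ) : Prop where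
  map_one : L 1 = 1
  le : ∀ (x : EucSp n) (r : ℝ), 0 < r → ∀ (u : EucSp n → ℝ)
    (g : C(Metric.sphere (0 : EucSp n) 1, ℝ)), ContinuousOn u (Metric.closedBall x r) →
    ViscOn {A | 0 ≤ ℓ A} (Metric.ball x r) u → (∀ y, u (x + r • y.1) = g y) → u x ≤ L g

lemma exists_isMeanValue {ℓ : SymMat n →ₗ[ℝ] ℝ} (h1 : 0 < ℓ 1)
    (hP : ∀ A, SymPSD A → 0 ≤ ℓ A) : ∃ L, IsMeanValue ℓ L := by
  obtain ⟨L, hLn, hL⟩ := exists_sphere_functional h1 hP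
  have hone : L 1 = 1 := by
    have h2 : spherePolyMap n 1 = 1 := by ext y; simp [spherePolyMap_apply, polyFun]
    have := hL 1 (by
      simp [polyOp, LinearMap.sum_apply])
    rw [h2] at this
    rw [this]; simp [polyFun]
  have hpos : ∀ f, 0 ≤ f → 0 ≤ L f := by
    intro f hf
    have h2 : ‖‖f‖ • (1 : C(Metric.sphere (0 : EucSp n) 1, ℝ)) - f‖ ≤ ‖f‖ := by
      rw [ContinuousMap.norm_le _ (norm_nonneg _)]
      intro y
      have h3 : 0 ≤ f y := hf y
      have h4 := f.norm_coe_le_norm y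
      rw [Real.norm_eq_abs] at h4 ⊢
      have h5 := le_abs_self (f y)
      simp only [ContinuousMap.sub_apply, ContinuousMap.smul_apply, ContinuousMap.one_apply,
        smul_eq_mul, mul_one]
      rw [abs_le]; constructor <;> linarith
    have h3 := (L.le_opNorm _).trans (mul_le_mul hLn h2 (norm_nonneg _) zero_le_one)
    rw [map_sub, map_smul, hone, Real.norm_eq_abs] at h3
    have := le_of_abs_le h3
    simp only [smul_eq_mul, mul_one, one_mul] at this
    linarith
  have hmono : ∀ f g, f ≤ g → L f ≤ L g := by
    intro f g hfg
    have := hpos (g - f) (sub_nonneg.2 hfg)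
    rw [map_sub] at this; linarith
  refine ⟨L, hone, ?_⟩
  intro x r hr u g hu hv hg
  refine le_of_forall_pos_le_add fun ε hε => ?_
  have hgc : Continuous g := g.continuous
  obtain ⟨p, hp⟩ := exists_polyFun_near (isCompact_sphere (0 : EucSp n) 1)
    (f := fun y => u (x + r • y)) (by
      rw [continuousOn_iff_continuous_domRestrict]
      convert hgc using 1
      ext y; exact hg y) (half_pos hε)
  obtain ⟨q, hq, hqp⟩ := exists_polyOp_eq_zero h1 hP p
  have hq' : ∀ y : Metric.sphere (0 : EucSp n) 1, |polyFun q y.1 - g y| ≤ ε / 2 := by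
    intro y
    rw [hqp _ y.2, ← hg]
    exact hp _ y.2
  have hle : ∀ y ∈ Metric.closedBall x r,
      u y ≤ polyFun q (-(r⁻¹ • x) + r⁻¹ • y) + ε / 2 := by
    have hc : ContDiff ℝ 2 fun y => polyFun q (-(r⁻¹ • x) + r⁻¹ • y) := by
      have h2 : ContDiff ℝ 2 fun y : EucSp n => -(r⁻¹ • x) + r⁻¹ • y := by fun_prop
      exact (contDiff_polyFun q).comp h2
    refine ViscOn.le_of_le_sphere h1 hu hv (hc.add contDiff_const) (fun y _ => ?_) fun y hy => ?_
    · rw [symHess_add_const hc.contDiffAt, symHess_comp_affine (contDiff_polyFun q).contDiffAt,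
        map_smul, ← polyFun_polyOp, hq]
      simp [polyFun]
    · have h2 : -(r⁻¹ • x) + r⁻¹ • y ∈ Metric.sphere (0 : EucSp n) 1 := by
        rw [mem_sphere_zero_iff_norm, ← sub_eq_neg_add, ← smul_sub, norm_smul,
          mem_sphere_iff_norm.1 hy, norm_inv, Real.norm_of_nonneg hr.le, inv_mul_cancel₀ hr.ne']
      have h3 := hq' ⟨_, h2⟩
      rw [← hg] at h3
      have h4 : x + r • (-(r⁻¹ • x) + r⁻¹ • y) = y := by
        rw [smul_add, smul_neg, smul_smul, smul_smul, mul_inv_cancel₀ hr.ne']; simp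
      simp only [h4] at h3
      linarith [neg_le_of_abs_le h3]
  have h0 := hle x (Metric.mem_closedBall_self hr.le)
  rw [neg_add_cancel, ← hL q hq] at h0
  have h2 : L (spherePolyMap n q) ≤ L (g + (ε / 2) • 1) := by
    refine hmono _ _ fun y => ?_
    have := le_of_abs_le (hq' y)
    show spherePolyMap n q y ≤ (g + (ε / 2) • 1 : C(Metric.sphere (0 : EucSp n) 1, ℝ)) y
    simp only [spherePolyMap_apply, ContinuousMap.add_apply, ContinuousMap.smul_apply,
      ContinuousMap.one_apply, smul_eq_mul, mul_one]
    linarith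
  rw [map_add, map_smul, hone] at h2
  simp only [smul_eq_mul, mul_one] at h2
  linarith

lemma nonneg_symHess_of_meanValue {ℓ : SymMat n →ₗ[ℝ] ℝ} (hc : Continuous ℓ) (h1 : 0 < ℓ 1)
    (hP : ∀ A, SymPSD A → 0 ≤ ℓ A) {L : C(Metric.sphere (0 : EucSp n) 1, ℝ) →L[ℝ] ℝ}
    (hL : IsMeanValue ℓ L) {v : EucSp n → ℝ} (hv : ContDiff ℝ 2 v) {x : EucSp n} {r₀ : ℝ}
    (hr₀ : 0 < r₀) (h : ∀ ρ, 0 < ρ → ρ < r₀ → ∀ g : C(Metric.sphere (0 : EucSp n) 1, ℝ),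
      (∀ y, v (x + ρ • y.1) = g y) → v x ≤ L g) : 0 ≤ ℓ (symHess v x) := by
  by_contra! hneg
  obtain ⟨δ, hδ, hδ2⟩ : ∃ δ : ℝ, 0 < δ ∧ ℓ (symHess v x) + δ * (2 * ℓ 1) < 0 := by
    refine ⟨-ℓ (symHess v x) / (4 * ℓ 1), by have := neg_pos.2 hneg; positivity, ?_⟩
    have : -ℓ (symHess v x) / (4 * ℓ 1) * (2 * ℓ 1) = -ℓ (symHess v x) / 2 := by
      field_simp; ring
    rw [this]; linarith
  have hev : ∀ᶠ y in 𝓝 x, ℓ (symHess v y) + δ * (2 * ℓ 1) < 0 := by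
    have hca : ContinuousAt (fun y => ℓ (symHess v y) + δ * (2 * ℓ 1)) x :=
      (hc.continuousAt.comp (continuousAt_symHess hv.contDiffAt)).add continuousAt_const
    exact hca.eventually (isOpen_Iio.mem_nhds hδ2)
  obtain ⟨ρ₁, hρ₁, hball⟩ := Metric.eventually_nhds_iff_ball.1 hev
  obtain ⟨ρ, hρ, hρr, hρρ⟩ : ∃ ρ : ℝ, 0 < ρ ∧ ρ < r₀ ∧ ρ < ρ₁ :=
    ⟨min r₀ ρ₁ / 2, by positivity, by linarith [min_le_left r₀ ρ₁], by linarith [min_le_right r₀ ρ₁]⟩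
  have hvc := hv.continuous
  let g : C(Metric.sphere (0 : EucSp n) 1, ℝ) := ⟨fun y => v (x + ρ • y.1), by fun_prop⟩
  have hg := h ρ hρ hρr g fun _ => rfl
  have hq := contDiff_norm_sub_sq x
  have hw : ContDiff ℝ 2 fun y => -(v y + δ * ‖y - x‖ ^ 2) := (hv.add (contDiff_const.mul hq)).neg
  have := hL.le x ρ hρ (fun y => -(v y + δ * ‖y - x‖ ^ 2)) (-(g + (δ * ρ ^ 2) • 1))
    hw.continuous.continuousOn
    (ViscOn.of_contDiffAt (halfspace_add_psd hP) (fun x _ => hw.contDiffAt) fun y hy => ?_)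
    (fun y => ?_)
  · rw [map_neg, map_add, map_smul, hL.map_one] at this
    simp only [sub_self, norm_zero, smul_eq_mul, mul_one] at this
    have h3 : 0 < δ * ρ ^ 2 := by positivity
    linarith
  · show 0 ≤ ℓ _
    rw [symHess_neg (hv.contDiffAt.add (contDiff_const.mul hq).contDiffAt),
      symHess_add_smul hv.contDiffAt hq.contDiffAt, symHess_norm_sub_sq, map_neg, map_add,
      map_smul, map_smul]
    have := hball y (Metric.ball_subset_ball hρρ.le hy)
    simp only [smul_eq_mul]
    linarith
  · have hy := mem_sphere_zero_iff_norm.1 y.2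
    simp [g, norm_smul, hy]

open MeasureTheory in
/-- Smooth approximation of continuous viscosity subsolutions of a convex cone subequation. -/
lemma exists_contDiff_approx {F : ConeSubequation n} (hF : Convex ℝ F.carrier)
    {X K : Set (EucSp n)} (hX : IsOpen X) (hK : IsCompact K) (hKX : K ⊆ X) {u : EucSp n → ℝ}
    (hu : ContinuousOn u X) (hv : ViscOn F.carrier X u) {ε : ℝ} (hε : 0 < ε) :
    ∃ g : EucSp n → ℝ, ContDiff ℝ 2 g ∧
      ∀ x ∈ K, |g x - u x| ≤ ε ∧ symHess g x ∈ F.carrier := by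
  obtain ⟨d, hd, hdX⟩ := hK.exists_cthickening_subset_open hX hKX
  obtain ⟨w, hw⟩ := ContinuousMap.exists_restrict_eq (Metric.isClosed_cthickening (δ := d) (E := K))
    ⟨_, (hu.mono hdX).domRestrict⟩
  have hwu : ∀ x ∈ Metric.cthickening d K, w x = u x := fun x hx =>
    congrArg (fun f : C(Metric.cthickening d K, ℝ) => f ⟨x, hx⟩) hw
  have hwv : ViscOn F.carrier (Metric.thickening d K) w := by
    have hsub := Metric.thickening_subset_cthickening d K
    exact (hv.mono (hsub.trans hdX)).congr Metric.isOpen_thickening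
      fun x hx => (hwu x (hsub hx)).symm
  obtain ⟨r, hr, hrd, hrε⟩ : ∃ r : ℝ, 0 < r ∧ r < d / 2 ∧
      ∀ x ∈ K, ∀ y ∈ Metric.ball x r, dist (w y) (w x) ≤ ε := by
    have := hK.uniformContinuousAt_of_continuousAt w (fun a _ => w.continuous.continuousAt)
      (Metric.dist_mem_uniformity hε)
    obtain ⟨r, hr, h⟩ := Metric.mem_uniformity_dist.1 this
    refine ⟨min r (d / 3), by positivity, (min_le_right _ _).trans_lt (by linarith), ?_⟩
    intro x hx y hy
    have := h (a := x) (b := y) (by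
      rw [dist_comm]; exact (Metric.mem_ball.1 hy).trans_le (min_le_left _ _)) hx
    rw [dist_comm]
    exact le_of_lt this
  let φ : ContDiffBump (0 : EucSp n) := ⟨r / 2, r, by positivity, by linarith⟩
  let k : EucSp n → ℝ := φ.normed volume
  have hkc : Continuous k := φ.continuous_normed
  have hks : HasCompactSupport k := φ.hasCompactSupport_normed
  have hk0 : ∀ t, 0 ≤ k t := φ.nonneg_normed
  have hksupp : ∀ t, k t ≠ 0 → ‖t‖ < r := by
    intro t ht
    have : t ∈ Function.support k := ht
    rw [φ.support_normed_eq] at this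
    simpa using this
  let v : EucSp n → ℝ := convolution k w (ContinuousLinearMap.lsmul ℝ ℝ) volume
  have hv_eq : ∀ x, v x = ∫ t, k t * w (x - t) := fun x => rfl
  have hvd : ContDiff ℝ 2 v :=
    hks.contDiff_convolution_left _ φ.contDiff_normed w.continuous.locallyIntegrable
  refine ⟨v, hvd, fun x hx => ⟨?_, ?_⟩⟩
  · rw [← hwu x (Metric.self_subset_cthickening K hx)]
    exact φ.dist_normed_convolution_le w.continuous.aestronglyMeasurable (hrε x hx)
  refine F.mem_of_forall_functional hF fun ℓ hc hℓF h1 => ?_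
  have hP : ∀ A, SymPSD A → 0 ≤ ℓ A := fun A hA => hℓF A (F.psd_mem hA)
  obtain ⟨L, hL⟩ := exists_isMeanValue h1 hP
  refine nonneg_symHess_of_meanValue hc h1 hP hL hvd (half_pos hd) fun ρ hρ hρd g hg => ?_
  let G : EucSp n → C(Metric.sphere (0 : EucSp n) 1, ℝ) := fun t =>
    ⟨fun y => w (x - t + ρ • y.1), by fun_prop⟩
  have hG : Continuous G := by
    refine ContinuousMap.continuous_of_continuous_uncurry _ ?_
    show Continuous fun p : EucSp n × Metric.sphere (0 : EucSp n) 1 => w (x - p.1 + ρ • p.2.1)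
    fun_prop
  have hInt : Integrable fun t => k t • G t :=
    (hkc.smul hG).integrable_of_hasCompactSupport hks.smul_right
  have hgG : ∫ t, k t • G t = g := by
    ext y
    have h2 := (ContinuousMap.evalCLM ℝ y).integral_comp_comm hInt
    simp only [ContinuousMap.evalCLM_apply] at h2
    rw [← h2, ← hg y, hv_eq]
    refine integral_congr_ae (Eventually.of_forall fun t => ?_)
    show k t * w (x - t + ρ • y.1) = k t * w (x + ρ • y.1 - t)
    rw [sub_add_eq_add_sub]
  rw [← hgG, ← L.integral_comp_comm hInt, hv_eq]
  refine integral_mono ?_ (L.integrable_comp hInt) fun t => ?_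
  · refine Continuous.integrable_of_hasCompactSupport ?_ (hks.mul_right)
    have := w.continuous
    fun_prop
  · simp only [map_smul, smul_eq_mul]
    by_cases ht : k t = 0
    · simp [ht]
    refine mul_le_mul_of_nonneg_left ?_ (hk0 t)
    refine hL.le (x - t) ρ hρ w (G t) w.continuous.continuousOn ?_ fun y => rfl
    refine (hwv.mono_set hℓF).mono fun y hy => ?_
    rw [Metric.mem_thickening_iff]
    refine ⟨x, hx, ?_⟩
    have h2 := hksupp t ht
    rw [Metric.mem_ball, dist_eq_norm] at hy
    rw [dist_eq_norm]
    calc ‖y - x‖ = ‖(y - (x - t)) - t‖ := by congr 1; abel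
      _ ≤ ‖y - (x - t)‖ + ‖t‖ := norm_sub_le _ _
      _ < d := by linarith

lemma mem_of_mem_closure_of_notMem_frontier {X : Set (EucSp n)} (hX : IsOpen X) {x : EucSp n}
    (hx : x ∈ closure X) (hx' : x ∉ frontier X) : x ∈ X := by
  by_contra h
  exact hx' ⟨hx, by rwa [hX.interior_eq]⟩

/-- Comparison principle for a nonnegative combination of two subsolutions and a supersolution. -/
lemma comparison {F : ConeSubequation n} (hF : Convex ℝ F.carrier) {X : Set (EucSp n)}
    (hX : IsOpen X) (hXb : Bornology.IsBounded X) {u w v : EucSp n → ℝ}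
    (hu : ContinuousOn u (closure X)) (hw : ContinuousOn w (closure X))
    (hv : ContinuousOn v (closure X)) (huv : ViscOn F.carrier X u) (hwv : ViscOn F.carrier X w)
    (hvv : ViscOn (dualSet F.carrier) X (fun x => -v x)) {α β M : ℝ} (hα : 0 ≤ α) (hβ : 0 ≤ β)
    (hle : ∀ x ∈ frontier X, α * u x + β * w x - v x ≤ M) :
    ∀ x ∈ closure X, α * u x + β * w x - v x ≤ M := by
  intro y₀ hy₀
  by_contra! hlt
  have hcX := hXb.isCompact_closure
  set f : EucSp n → ℝ := fun x => α * u x + β * w x - v x with hf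
  have hfc : ContinuousOn f (closure X) :=
    ((continuousOn_const.mul hu).add (continuousOn_const.mul hw)).sub hv
  set m := f y₀ - M with hm
  have hm0 : 0 < m := sub_pos.2 hlt
  set K := {x ∈ closure X | M + m / 2 ≤ f x} with hKdef
  have hK : IsCompact K := by
    refine hcX.of_isClosed_subset ?_ fun x hx => hx.1
    exact hfc.preimage_isClosed_of_isClosed isClosed_closure isClosed_Ici
  have hKX : K ⊆ X := by
    intro x hx
    refine mem_of_mem_closure_of_notMem_frontier hX hx.1 fun hxf => ?_
    have h1 : f x ≤ M := hle x hxf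
    have h2 := hx.2
    linarith
  have hy₀K : y₀ ∈ K := ⟨hy₀, by linarith⟩
  obtain ⟨ε, hε, hεm⟩ : ∃ ε : ℝ, 0 < ε ∧ (α + β) * ε ≤ m / 16 := by
    refine ⟨m / (16 * (α + β + 1)), by positivity, ?_⟩
    rw [mul_div_assoc', div_le_div_iff₀ (by positivity) (by positivity)]
    nlinarith
  obtain ⟨g₁, hg₁, hg₁K⟩ := exists_contDiff_approx hF hX hK hKX (hu.mono subset_closure) huv hε
  obtain ⟨g₂, hg₂, hg₂K⟩ := exists_contDiff_approx hF hX hK hKX (hw.mono subset_closure) hwv hε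
  obtain ⟨R, hR⟩ := hcX.isBounded.exists_norm_le
  obtain ⟨δ, hδ, hδm⟩ : ∃ δ : ℝ, 0 < δ ∧ δ * R ^ 2 ≤ m / 16 := by
    refine ⟨m / (16 * (R ^ 2 + 1)), by positivity, ?_⟩
    rw [div_mul_eq_mul_div, div_le_div_iff₀ (by positivity) (by positivity)]
    nlinarith
  have hGabs : ∀ x ∈ K, |(α * g₁ x + β * g₂ x) - (α * u x + β * w x)| ≤ m / 16 := by
    intro x hx
    have h1 := (hg₁K x hx).1
    have h2 := (hg₂K x hx).1
    calc |(α * g₁ x + β * g₂ x) - (α * u x + β * w x)|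
        = |α * (g₁ x - u x) + β * (g₂ x - w x)| := by congr 1; ring
      _ ≤ |α * (g₁ x - u x)| + |β * (g₂ x - w x)| := abs_add_le _ _
      _ = α * |g₁ x - u x| + β * |g₂ x - w x| := by
          rw [abs_mul, abs_mul, abs_of_nonneg hα, abs_of_nonneg hβ]
      _ ≤ α * ε + β * ε := by gcongr
      _ ≤ m / 16 := by linarith
  set G : EucSp n → ℝ := fun x => (α * g₁ x + β * g₂ x) + δ * ‖x - 0‖ ^ 2 with hG
  have hq := contDiff_norm_sub_sq (0 : EucSp n)
  have hg : ContDiff ℝ 2 fun x => α * g₁ x + β * g₂ x :=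
    (contDiff_const.mul hg₁).add (contDiff_const.mul hg₂)
  have hGd : ContDiff ℝ 2 G := hg.add (contDiff_const.mul hq)
  obtain ⟨z, hz, hmax⟩ := hK.exists_isMaxOn ⟨y₀, hy₀K⟩
    (f := fun x => G x - v x) (hGd.continuous.continuousOn.sub (hv.mono fun x hx => hx.1))
  have hz0 := hmax hy₀K
  simp only [Set.mem_ofPred_eq, hG, sub_zero] at hz0
  have hfz : M + m / 2 < f z := by
    have h1 := abs_le.1 (hGabs z hz)
    have h2 := abs_le.1 (hGabs y₀ hy₀K)
    have h3 : ‖z‖ ^ 2 ≤ R ^ 2 := by gcongr; exact hR z hz.1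
    have h4 : 0 ≤ δ * ‖y₀‖ ^ 2 := by positivity
    have h5 : δ * ‖z‖ ^ 2 ≤ δ * R ^ 2 := by gcongr
    simp only [hf] at hm ⊢
    linarith [h1.1, h1.2, h2.1, h2.2]
  have hzX := hKX hz
  have hKn : K ∈ 𝓝 z := by
    have h1 : ContinuousAt f z := hfc.continuousAt (mem_of_superset (hX.mem_nhds hzX) subset_closure)
    filter_upwards [h1.eventually (isOpen_Ioi.mem_nhds hfz), hX.mem_nhds hzX] with y hy hyX
    exact ⟨subset_closure hyX, le_of_lt hy⟩
  have hmem := hvv z hzX (fun y => -G y + (G z - v z)) (hGd.contDiffAt.neg.add contDiffAt_const)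
    (by
      filter_upwards [hKn] with y hy
      have := hmax hy
      simp only [Set.mem_ofPred_eq] at this
      linarith) (by ring)
  rw [symHess_add_const hGd.contDiffAt.neg, symHess_neg hGd.contDiffAt] at hmem
  apply hmem
  rw [neg_neg, hG, symHess_add_smul hg.contDiffAt hq.contDiffAt, symHess_norm_sub_sq, smul_smul,
    symHess_add (contDiff_const.mul hg₁).contDiffAt (contDiff_const.mul hg₂).contDiffAt,
    symHess_const_mul hg₁.contDiffAt, symHess_const_mul hg₂.contDiffAt]
  exact F.add_smul_one_mem_interior (F.add_mem hF (F.smul_mem (hg₁K z hz).2 hα)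
    (F.smul_mem (hg₂K z hz).2 hβ)) (by positivity)

/-- Comparison principle for a subsolution and a supersolution. -/
lemma comparison_le {F : ConeSubequation n} (hF : Convex ℝ F.carrier) {X : Set (EucSp n)}
    (hX : IsOpen X) (hXb : Bornology.IsBounded X) {u v : EucSp n → ℝ}
    (hu : ContinuousOn u (closure X)) (hv : ContinuousOn v (closure X))
    (huv : ViscOn F.carrier X u) (hvv : ViscOn (dualSet F.carrier) X (fun x => -v x)) {M : ℝ}
    (hle : ∀ x ∈ frontier X, u x - v x ≤ M) : ∀ x ∈ closure X, u x - v x ≤ M := by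
  have := comparison hF hX hXb hu hu hv huv huv hvv (α := 1) (β := 0) (M := M) zero_le_one le_rfl
    (by simpa using hle)
  simpa using this

lemma ViscOn.add {F : ConeSubequation n} (hF : Convex ℝ F.carrier) {X : Set (EucSp n)}
    (hX : IsOpen X) {u w : EucSp n → ℝ} (hu : ContinuousOn u X) (hw : ContinuousOn w X)
    (huv : ViscOn F.carrier X u) (hwv : ViscOn F.carrier X w) :
    ViscOn F.carrier X (fun x => u x + w x) := by
  refine ViscOn.of_approx F.isClosed' fun z hz => ?_
  obtain ⟨r, hr, hrX⟩ := Metric.nhds_basis_closedBall.mem_iff.1 (hX.mem_nhds hz)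
  refine ⟨r, hr, fun ε hε => ?_⟩
  have hK := isCompact_closedBall z r
  obtain ⟨g₁, hg₁, hg₁K⟩ := exists_contDiff_approx hF hX hK hrX hu huv (half_pos hε)
  obtain ⟨g₂, hg₂, hg₂K⟩ := exists_contDiff_approx hF hX hK hrX hw hwv (half_pos hε)
  refine ⟨fun x => g₁ x + g₂ x, (hg₁.add hg₂).continuous.continuousOn, ?_, fun x hx => ?_, ?_⟩
  · refine ViscOn.of_contDiffAt (fun A hA P hP => F.add_psd_mem hA hP)
      (fun x _ => (hg₁.add hg₂).contDiffAt) fun x hx => ?_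
    rw [symHess_add hg₁.contDiffAt hg₂.contDiffAt]
    have hx' := Metric.ball_subset_closedBall hx
    exact F.add_mem hF (hg₁K x hx').2 (hg₂K x hx').2
  · have h1 := abs_le.1 (hg₁K x hx).1
    have h2 := abs_le.1 (hg₂K x hx).1
    linarith [h1.2, h2.2]
  · have hz' := Metric.mem_closedBall_self (x := z) hr.le
    have h1 := abs_le.1 (hg₁K z hz').1
    have h2 := abs_le.1 (hg₂K z hz').1
    linarith [h1.1, h2.1]

/-- Continuous subsolutions lying between two obstacles. -/
def obstacleFamily (F : ConeSubequation n) (X : Set (EucSp n)) (g₁ g₂ : EucSp n → ℝ) :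
    Set (EucSp n → ℝ) :=
  {w | ContinuousOn w (closure X) ∧ ViscOn F.carrier X w ∧
    ∀ x ∈ closure X, g₁ x ≤ w x ∧ w x ≤ g₂ x}

/-- The Perron envelope of subsolutions between two obstacles. -/
def perronSup (F : ConeSubequation n) (X : Set (EucSp n)) (g₁ g₂ : EucSp n → ℝ) (x : EucSp n) : ℝ :=
  sSup ((fun w : EucSp n → ℝ => w x) '' obstacleFamily F X g₁ g₂)

section Perron

variable {F : ConeSubequation n} {X : Set (EucSp n)} {g₁ g₂ : EucSp n → ℝ}

lemma le_perronSup {w : EucSp n → ℝ} (hw : w ∈ obstacleFamily F X g₁ g₂) {x : EucSp n}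
    (hx : x ∈ closure X) : w x ≤ perronSup F X g₁ g₂ x := by
  refine le_csSup ⟨g₂ x, ?_⟩ ⟨w, hw, rfl⟩
  rintro _ ⟨v, hv, rfl⟩
  exact (hv.2.2 x hx).2

lemma perronSup_le (hne : (obstacleFamily F X g₁ g₂).Nonempty) {x : EucSp n} {a : ℝ}
    (h : ∀ w ∈ obstacleFamily F X g₁ g₂, w x ≤ a) : perronSup F X g₁ g₂ x ≤ a := by
  refine csSup_le (hne.image _) ?_
  rintro _ ⟨v, hv, rfl⟩
  exact h v hv

lemma exists_lt_of_perronSup (hne : (obstacleFamily F X g₁ g₂).Nonempty) {x : EucSp n} {ε : ℝ}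
    (hε : 0 < ε) : ∃ w ∈ obstacleFamily F X g₁ g₂, perronSup F X g₁ g₂ x - ε < w x := by
  obtain ⟨_, ⟨w, hw, rfl⟩, hlt⟩ := exists_lt_of_lt_csSup (hne.image fun w : EucSp n → ℝ => w x)
    (sub_lt_self (perronSup F X g₁ g₂ x) hε)
  exact ⟨w, hw, hlt⟩

/-- Translation estimate for the Perron envelope. -/
lemma perronSup_add_le (hX : IsOpen X) (hXb : Bornology.IsBounded X)
    (hc₁ : ContinuousOn g₁ (closure X)) (hc₂ : ContinuousOn g₂ (closure X))
    (heq : ∀ x ∈ frontier X, g₁ x = g₂ x) (hne : (obstacleFamily F X g₁ g₂).Nonempty)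
    {ε : ℝ} (hε : 0 < ε) : ∃ η > 0, ∀ x y, x ∈ X → x + y ∈ X → ‖y‖ < η →
      perronSup F X g₁ g₂ (x + y) ≤ perronSup F X g₁ g₂ x + ε := by
  have hC := hXb.isCompact_closure
  have huc := hC.uniformContinuousOn_of_continuous hc₂
  rw [Metric.uniformContinuousOn_iff] at huc
  obtain ⟨η₁, hη₁, hmod⟩ := huc (ε / 2) (half_pos hε)
  set K := {x ∈ closure X | ε / 2 ≤ g₂ x - g₁ x} with hKdef
  have hK : IsCompact K := by
    refine hC.of_isClosed_subset ?_ fun x hx => hx.1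
    exact (hc₂.sub hc₁).preimage_isClosed_of_isClosed isClosed_closure isClosed_Ici
  have hKX : K ⊆ X := by
    intro x hx
    refine mem_of_mem_closure_of_notMem_frontier hX hx.1 fun hxf => ?_
    have h2 := hx.2
    rw [heq x hxf] at h2
    linarith
  obtain ⟨η₂, hη₂, hthick⟩ := hK.exists_cthickening_subset_open hX hKX
  refine ⟨min η₁ η₂, lt_min hη₁ hη₂, fun x y hx hxy hy => ?_⟩
  refine perronSup_le hne fun w hw => ?_
  set V := {z | z ∈ X ∧ z + y ∈ X} with hVdef
  have hVo : IsOpen V := hX.inter (hX.preimage (continuous_add_const y))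
  have hg : ∀ z ∈ X, z + y ∈ X → g₂ (z + y) - ε / 2 ≤ g₂ z := by
    intro z hz hzy
    have := hmod (z + y) (subset_closure hzy) z (subset_closure hz)
      (by simpa using hy.trans_le (min_le_left _ _))
    rw [Real.dist_eq] at this
    linarith [(abs_lt.1 this).2]
  have hmem : glueMax V w (fun z => w (z + y) + -ε) ∈ obstacleFamily F X g₁ g₂ := by
    refine ⟨?_, ?_, fun z hz => ⟨(hw.2.2 z hz).1.trans (le_glueMax _ _ _ _), ?_⟩⟩
    · refine continuousOn_glueMax hVo hw.1 ?_ hK.isClosed ?_ ?_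
      · refine ContinuousOn.add ?_ continuousOn_const
        refine hw.1.comp (by fun_prop) fun z hz => subset_closure hz.1.2
      · intro z hz
        refine ⟨hKX hz, hthick ?_⟩
        refine Metric.mem_cthickening_of_dist_le _ z _ _ hz ?_
        simpa using hy.le.trans (min_le_right _ _)
      · rintro z ⟨hzV, hzC⟩ hzK
        have h1 : g₂ z - g₁ z < ε / 2 := by
          by_contra! h
          exact hzK ⟨hzC, h⟩
        have h2 := hg z hzV.1 hzV.2
        have h3 := (hw.2.2 (z + y) (subset_closure hzV.2)).2
        have h4 := (hw.2.2 z hzC).1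
        show w (z + y) + -ε ≤ w z
        linarith
    · exact ViscOn.glueMax hVo hw.2.1 (((hw.2.1.comp_add y).mono fun z hz => hz.2).add_const _)
    · rw [glueMax]
      split_ifs with hzV
      · refine max_le (hw.2.2 z hz).2 ?_
        have h2 := hg z hzV.1 hzV.2
        have h3 := (hw.2.2 (z + y) (subset_closure hzV.2)).2
        linarith
      · exact (hw.2.2 z hz).2
  have h1 := le_perronSup hmem (subset_closure hx)
  have h2 := le_glueMax_of_mem (V := V) w (fun z => w (z + y) + -ε) (x := x) ⟨hx, hxy⟩
  linarith

/-- Perron's method between two obstacles that agree on the boundary. -/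
lemma exists_harmonic_between (hX : IsOpen X) (hXb : Bornology.IsBounded X)
    (hc₁ : ContinuousOn g₁ (closure X)) (hc₂ : ContinuousOn g₂ (closure X))
    (hle : ∀ x ∈ closure X, g₁ x ≤ g₂ x)
    (heq : ∀ x ∈ frontier X, g₁ x = g₂ x) (hv₁ : ViscOn F.carrier X g₁)
    (hv₂ : ViscOn (dualSet F.carrier) X (fun x => -g₂ x)) :
    ∃ H : EucSp n → ℝ, ContinuousOn H (closure X) ∧ (∀ x ∈ closure X, g₁ x ≤ H x ∧ H x ≤ g₂ x) ∧
      ViscOn F.carrier X H ∧ ViscOn (dualSet F.carrier) X (fun x => -H x) := by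
  have hg₁ : g₁ ∈ obstacleFamily F X g₁ g₂ := ⟨hc₁, hv₁, fun x hx => ⟨le_rfl, hle x hx⟩⟩
  have hne : (obstacleFamily F X g₁ g₂).Nonempty := ⟨_, hg₁⟩
  set H := perronSup F X g₁ g₂ with hH
  have hb : ∀ x ∈ closure X, g₁ x ≤ H x ∧ H x ≤ g₂ x := fun x hx =>
    ⟨le_perronSup hg₁ hx, perronSup_le hne fun w hw => (hw.2.2 x hx).2⟩
  have hHc : ContinuousOn H (closure X) := by
    intro x hx
    by_cases hxf : x ∈ frontier X
    · have h1 := hc₁ x hx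
      have h2 := hc₂ x hx
      have h3 : H x = g₁ x := le_antisymm ((hb x hx).2.trans (heq x hxf).ge) (hb x hx).1
      rw [ContinuousWithinAt, h3]
      rw [ContinuousWithinAt, ← heq x hxf] at h2
      refine tendsto_of_tendsto_of_tendsto_of_le_of_le' h1 h2 ?_ ?_
      · filter_upwards [self_mem_nhdsWithin] with y hy using (hb y hy).1
      · filter_upwards [self_mem_nhdsWithin] with y hy using (hb y hy).2
    · have hxX := mem_of_mem_closure_of_notMem_frontier hX hx hxf
      refine ContinuousAt.continuousWithinAt ?_
      rw [Metric.continuousAt_iff']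
      intro ε hε
      obtain ⟨η, hη, h⟩ := perronSup_add_le hX hXb hc₁ hc₂ heq hne (half_pos hε)
      filter_upwards [Metric.ball_mem_nhds x hη, hX.mem_nhds hxX] with y hy hyX
      rw [Metric.mem_ball, dist_eq_norm] at hy
      have h1 := h x (y - x) hxX (by simpa using hyX) hy
      have h2 := h y (x - y) hyX (by simpa using hxX) (by rwa [norm_sub_rev])
      rw [add_sub_cancel] at h1 h2
      rw [Real.dist_eq, abs_lt]
      constructor <;> linarith
  have hHv : ViscOn F.carrier X H := by
    refine ViscOn.of_approx F.isClosed' fun z hz => ?_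
    obtain ⟨r, hr, hrX⟩ := Metric.nhds_basis_closedBall.mem_iff.1 (hX.mem_nhds hz)
    refine ⟨r, hr, fun ε hε => ?_⟩
    obtain ⟨w, hw, hlt⟩ := exists_lt_of_perronSup hne (x := z) hε
    refine ⟨w, hw.1.mono (hrX.trans subset_closure),
      hw.2.1.mono (Metric.ball_subset_closedBall.trans hrX), fun x hx => ?_, hlt.le⟩
    linarith [le_perronSup hw (subset_closure (hrX hx))]
  refine ⟨H, hHc, hb, hHv, fun z hz ψ hψ hψle hψeq => ?_⟩
  by_contra hnot
  have hInt : -symHess ψ z ∈ interior F.carrier := not_not.1 hnot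
  have hzC := subset_closure hz
  rcases (hb z hzC).2.eq_or_lt with hHg | hHg
  · refine hnot (hv₂ z hz ψ hψ ?_ (by simpa only [hHg] using hψeq))
    filter_upwards [hψle, hX.mem_nhds hz] with y hy hyX
    linarith [(hb y (subset_closure hyX)).2]
  obtain ⟨δ, hδ, hδint⟩ := F.exists_sub_smul_one_mem hInt
  have hψn : ContDiffAt ℝ 2 (fun y => -ψ y) z := hψ.neg
  have hev1 : ∀ᶠ y in 𝓝 z, symHess (fun y => -ψ y) y - δ • (1 : SymMat n) ∈ interior F.carrier := by
    have hca : ContinuousAt (fun y => symHess (fun y => -ψ y) y - δ • (1 : SymMat n)) z :=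
      (continuousAt_symHess hψn).sub continuousAt_const
    refine hca.eventually (isOpen_interior.mem_nhds ?_)
    show symHess (fun y => -ψ y) z - δ • (1 : SymMat n) ∈ interior F.carrier
    rw [symHess_neg hψ]
    exact hδint
  have hcH : ContinuousAt H z := hHc.continuousAt (mem_of_superset (hX.mem_nhds hz) subset_closure)
  have hcg : ContinuousAt g₂ z := hc₂.continuousAt (mem_of_superset (hX.mem_nhds hz) subset_closure)
  have hev2 : ∀ᶠ y in 𝓝 z, (g₂ z - H z) / 2 < g₂ y + ψ y := by
    have hca : ContinuousAt (fun y => g₂ y + ψ y) z := hcg.add hψ.continuousAt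
    refine hca.eventually (isOpen_Ioi.mem_nhds ?_)
    show (g₂ z - H z) / 2 < g₂ z + ψ z
    linarith
  obtain ⟨ρ, hρ, hball⟩ := Metric.eventually_nhds_iff_ball.1
    (((hev1.and hev2).and (hψle.and (hX.mem_nhds hz))).and (hψ.eventually (by simp)))
  set r := ρ / 2
  have hr : 0 < r := half_pos hρ
  have hrρ : Metric.ball z r ⊆ Metric.ball z ρ := Metric.ball_subset_ball (half_le_self hρ.le)
  set η := min (δ / 2 * (r / 2) ^ 2) ((g₂ z - H z) / 2)
  have hη : 0 < η := lt_min (by positivity) (by linarith)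
  set w : EucSp n → ℝ := fun y => (-ψ y + (-(δ / 2)) * ‖y - z‖ ^ 2) + η
  have hq := contDiff_norm_sub_sq z
  have hwd : ∀ y ∈ Metric.ball z r, ContDiffAt ℝ 2 (fun y => -ψ y + (-(δ / 2)) * ‖y - z‖ ^ 2) y :=
    fun y hy => (hball y (hrρ hy)).2.neg.add (contDiffAt_const.mul hq.contDiffAt)
  have hmem : glueMax (Metric.ball z r) H w ∈ obstacleFamily F X g₁ g₂ := by
    refine ⟨?_, ?_, fun y hy => ⟨(hb y hy).1.trans (le_glueMax _ _ _ _), ?_⟩⟩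
    · refine continuousOn_glueMax (K := Metric.closedBall z (r / 2)) Metric.isOpen_ball hHc ?_
        Metric.isClosed_closedBall (Metric.closedBall_subset_ball (half_lt_self hr)) ?_
      · intro y hy
        exact ((hwd y hy.1).add contDiffAt_const).continuousAt.continuousWithinAt
      · rintro y ⟨hy, -⟩ hyK
        have h1 : r / 2 ≤ ‖y - z‖ := by
          rw [← dist_eq_norm]; exact (not_le.1 hyK).le
        have h2 := (hball y (hrρ hy)).1.2.1
        have h3 : δ / 2 * (r / 2) ^ 2 ≤ δ / 2 * ‖y - z‖ ^ 2 := by gcongr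
        have h4 : η ≤ δ / 2 * (r / 2) ^ 2 := min_le_left _ _
        show (-ψ y + (-(δ / 2)) * ‖y - z‖ ^ 2) + η ≤ H y
        linarith
    · refine ViscOn.glueMax Metric.isOpen_ball hHv (ViscOn.add_const ?_ _)
      refine ViscOn.of_contDiffAt (fun A hA P hP => F.add_psd_mem hA hP) hwd fun y hy => ?_
      rw [symHess_add_smul (hball y (hrρ hy)).2.neg hq.contDiffAt, symHess_norm_sub_sq, smul_smul]
      have := interior_subset (hball y (hrρ hy)).1.1.1
      convert this using 1
      rw [sub_eq_add_neg, ← neg_smul]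
      congr 2
      ring
    · rw [glueMax]
      split_ifs with hyV
      · refine max_le (hb y hy).2 ?_
        have h1 := (hball y (hrρ hyV)).1.1.2
        have h2 : η ≤ (g₂ z - H z) / 2 := min_le_right _ _
        have h3 : 0 ≤ δ / 2 * ‖y - z‖ ^ 2 := by positivity
        show (-ψ y + (-(δ / 2)) * ‖y - z‖ ^ 2) + η ≤ g₂ y
        linarith
      · exact (hb y hy).2
  have h1 := le_perronSup hmem hzC
  have h2 := le_glueMax_of_mem H w (Metric.mem_ball_self hr : z ∈ Metric.ball z r)
  have h3 : w z = -ψ z + η := by simp [w]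
  linarith

end Perron

lemma dotProduct_toLp (e v : EucSp n) : (∑ i, e i * v i) = inner ℝ e v := by
  simp [PiLp.inner_apply, mul_comm]

lemma symQuad_symProj (e v : EucSp n) : symQuad (symProj e) v = (inner ℝ e v) ^ 2 := by
  rw [← dotProduct_toLp, sq, Finset.sum_mul_sum]
  refine Finset.sum_congr rfl fun i _ => Finset.sum_congr rfl fun j _ => ?_
  simp only [symProj, projMat, Matrix.of_apply]
  ring

lemma symPSD_symProj (e : EucSp n) : SymPSD (symProj e) := fun v => by
  rw [symQuad_symProj]; positivity

lemma continuous_symProj : Continuous (symProj : EucSp n → SymMat n) := by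
  refine Continuous.subtype_mk ?_ _
  refine continuous_matrix fun i j => ?_
  simp only [projMat, Matrix.of_apply]
  fun_prop

lemma symHess_mul_self {f : EucSp n → ℝ} {x : EucSp n} (hf : ContDiffAt ℝ 2 f x) :
    symHess (fun y => f y * f y) x =
      (2 * f x) • symHess f x + (2 : ℝ) • symProj (gradient f x) := by
  have h : fderiv ℝ (fun y => f y * f y) =ᶠ[𝓝 x] fun y => f y • fderiv ℝ f y + f y • fderiv ℝ f y := by
    filter_upwards [eventually_differentiableAt hf] with y hy
    exact fderiv_fun_mul hy hy
  have hd : DifferentiableAt ℝ f x := hf.differentiableAt (by norm_num)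
  have h2 := differentiableAt_fderiv hf
  have hder : HasFDerivAt (fun y => f y • fderiv ℝ f y) _ x := hd.hasFDerivAt.smul h2.hasFDerivAt
  have h1 : secDeriv (fun y => f y * f y) x = _ := h.fderiv_eq.trans (hder.add hder).fderiv
  have hg : ∀ i, gradient f x i = fderiv ℝ f x (stdVec i) := by
    intro i
    have h : inner ℝ (gradient f x) (stdVec i) = fderiv ℝ f x (stdVec i) := inner_gradient_left
    rw [← h, ← dotProduct_toLp]
    simp
  apply Subtype.ext
  ext i j
  rw [symHess_apply, h1]
  have h3 : ((2 * f x) • symHess f x + (2 : ℝ) • symProj (gradient f x)).1 i j =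
    (2 * f x) * (symHess f x).1 i j + 2 * (gradient f x i * gradient f x j) := rfl
  rw [h3, symHess_apply, hg, hg]
  simp only [add_apply, smul_apply, ContinuousLinearMap.smulRight_apply, smul_eq_mul, secDeriv]
  ring

lemma symQuad_eq_dotProduct (A : SymMat n) (v : EucSp n) :
    symQuad A v = dotProduct v.ofLp (Matrix.mulVec A.1 v.ofLp) := by
  simp [symQuad, dotProduct, Matrix.mulVec, Finset.mul_sum, mul_assoc]

lemma one_sub_projMat_mulVec (e v : EucSp n) :
    Matrix.mulVec (1 - projMat e) v.ofLp = (v - (inner ℝ e v : ℝ) • e).ofLp := by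
  rw [Matrix.sub_mulVec, Matrix.one_mulVec]
  ext i
  simp only [← dotProduct_toLp, projMat, Matrix.mulVec, dotProduct, Matrix.of_apply, Pi.sub_apply,
    PiLp.sub_apply, PiLp.smul_apply, smul_eq_mul, Finset.sum_mul]
  congr 1
  exact Finset.sum_congr rfl fun j _ => by ring

lemma dotProduct_conj_mulVec {Q H : Matrix (Fin n) (Fin n) ℝ} (hQ : Q.transpose = Q)
    (v : Fin n → ℝ) :
    dotProduct v (Matrix.mulVec (Q * H * Q) v) =
      dotProduct (Matrix.mulVec Q v) (Matrix.mulVec H (Matrix.mulVec Q v)) := by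
  rw [mul_assoc, ← Matrix.mulVec_mulVec, Matrix.dotProduct_mulVec, ← Matrix.mulVec_transpose, hQ,
    ← Matrix.mulVec_mulVec]

lemma symQuad_of_eq_secondFF {ρ : EucSp n → ℝ} {x : EucSp n} (hρ : ContDiffAt ℝ 2 ρ x) {t : ℝ}
    {B : SymMat n} (hB : B.1 = secondFF ρ x + t • projMat (innerNormal ρ x)) (v : EucSp n) :
    symQuad B v = ‖gradient ρ x‖⁻¹ *
        secDeriv ρ x (v - (inner ℝ (innerNormal ρ x) v : ℝ) • innerNormal ρ x)
          (v - (inner ℝ (innerNormal ρ x) v : ℝ) • innerNormal ρ x) +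
      t * (inner ℝ (innerNormal ρ x) v) ^ 2 := by
  have hQ : (1 - projMat (innerNormal ρ x)).transpose = 1 - projMat (innerNormal ρ x) := by
    have := projMat_selfAdjoint (innerNormal ρ x)
    rw [selfAdjoint.mem_iff, Matrix.star_eq_conjTranspose, Matrix.conjTranspose_eq_transpose_of_trivial] at this
    rw [Matrix.transpose_sub, Matrix.transpose_one, this]
  rw [← symQuad_symProj, symQuad_eq_dotProduct, hB, Matrix.add_mulVec, dotProduct_add, secondFF,
    Matrix.smul_mulVec, Matrix.smul_mulVec, dotProduct_smul, dotProduct_smul,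
    dotProduct_conj_mulVec hQ, one_sub_projMat_mulVec, hessMatrix_eq_symHess hρ,
    ← symQuad_eq_dotProduct, symQuad_symHess, symQuad_eq_dotProduct]
  rfl

/-- Strict boundary convexity at a point gives strict convexity after adding a large multiple of
the squared gradient direction. -/
lemma exists_symHess_add_mem_interior {F : ConeSubequation n} {ρ : EucSp n → ℝ} {x : EucSp n}
    (hρ : ContDiffAt ℝ 2 ρ x) (hg : gradient ρ x ≠ 0) {t : ℝ}
    (ht : secondFF ρ x + t • projMat (innerNormal ρ x) ∈ Subtype.val '' interior F.carrier) :
    ∃ s₀ : ℝ, ∀ s ≥ s₀, symHess ρ x + s • symProj (gradient ρ x) ∈ interior F.carrier := by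
  obtain ⟨B, hB, hBe⟩ := ht
  set g := ‖gradient ρ x‖ with hgdef
  have hg0 : 0 < g := norm_pos_iff.2 hg
  obtain ⟨δ, hδ, hInt⟩ := F.exists_sub_smul_one_mem (F.interior_smul hB hg0)
  set ν := innerNormal ρ x with hν
  have hνn : ‖ν‖ = 1 := by
    rw [hν, innerNormal, norm_neg, norm_smul, norm_inv, norm_norm]
    exact inv_mul_cancel₀ hg0.ne'
  have hgν : gradient ρ x = -(g • ν) := by
    rw [hν, innerNormal, smul_neg, smul_smul, mul_inv_cancel₀ hg0.ne', one_smul, neg_neg]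
  set D := secDeriv ρ x with hD
  have hsymm : ∀ v w, D v w = D w v := fun v w =>
    (hρ.isSymmSndFDerivAt (by simp)) v w
  refine ⟨(‖D‖ ^ 2 / δ + ‖D‖ + g * |t|) / g ^ 2, fun s hs => ?_⟩
  have hs' : ‖D‖ ^ 2 / δ + ‖D‖ + g * |t| ≤ s * g ^ 2 := by
    rwa [ge_iff_le, div_le_iff₀ (by positivity)] at hs
  have hP : SymPSD ((symHess ρ x + s • symProj (gradient ρ x)) - (g • B - δ • (1 : SymMat n))) := by
    intro v
    rw [symQuad_sub, symQuad_sub, symQuad_add, symQuad_smul, symQuad_smul, symQuad_smul,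
      symQuad_one, symQuad_symProj, symQuad_symHess, symQuad_of_eq_secondFF hρ hBe]
    rw [← hν, ← hgdef, ← hD, hgν, inner_neg_left, inner_smul_left]
    set a : ℝ := inner ℝ ν v
    simp only [map_sub, map_smul, sub_apply, smul_apply, smul_eq_mul, RCLike.conj_to_real]
    rw [hsymm v ν]
    have h1 : |D ν v| ≤ ‖D‖ * ‖v‖ := by
      have := D.le_opNorm₂ ν v
      rwa [hνn, mul_one, Real.norm_eq_abs] at this
    have h2 : |D ν ν| ≤ ‖D‖ := by
      have := D.le_opNorm₂ ν ν
      rwa [hνn, mul_one, mul_one, Real.norm_eq_abs] at this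
    have h3 : 2 * |a| * (‖D‖ * ‖v‖) ≤ δ * ‖v‖ ^ 2 + ‖D‖ ^ 2 / δ * a ^ 2 := by
      have h4 : δ * ‖v‖ ^ 2 + ‖D‖ ^ 2 / δ * a ^ 2 - 2 * |a| * (‖D‖ * ‖v‖) =
          (δ * ‖v‖ - ‖D‖ * |a|) ^ 2 / δ := by
        rw [← sq_abs a]; field_simp; ring
      have : 0 ≤ (δ * ‖v‖ - ‖D‖ * |a|) ^ 2 / δ := by positivity
      linarith
    have h5 : 2 * a * D ν v ≥ -(2 * |a| * (‖D‖ * ‖v‖)) := by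
      have : |2 * a * D ν v| ≤ 2 * |a| * (‖D‖ * ‖v‖) := by
        rw [abs_mul, abs_mul, abs_two]
        gcongr
      linarith [(abs_le.1 this).1]
    have h6 : a ^ 2 * D ν ν ≤ a ^ 2 * ‖D‖ :=
      mul_le_mul_of_nonneg_left ((le_abs_self _).trans h2) (sq_nonneg a)
    have h7 := mul_le_mul_of_nonneg_right hs' (sq_nonneg a)
    have h8 : g * t * a ^ 2 ≤ g * |t| * a ^ 2 := by
      gcongr
      exact le_abs_self t
    have h9 : g * (g⁻¹ * (D v v - a * D ν v - a * (D ν v - a * D ν ν)) + t * a ^ 2) =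
        D v v - 2 * a * D ν v + a ^ 2 * D ν ν + g * t * a ^ 2 := by
      field_simp; ring
    rw [h9]
    nlinarith
  have := F.interior_add_psd hInt hP
  rwa [add_sub_cancel] at this

lemma continuous_gradient_of_contDiff {ρ : EucSp n → ℝ} (hρ : ContDiff ℝ 2 ρ) :
    Continuous (gradient ρ) :=
  (InnerProductSpace.toDual ℝ (EucSp n)).symm.continuous.comp
    (hρ.continuous_fderiv (by norm_num))

/-- Uniform strict convexity of a defining function near the boundary, after adding a multiple
of its square. -/
lemma exists_forall_frontier_symHess {F : ConeSubequation n} {ρ : EucSp n → ℝ} {K : Set (EucSp n)}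
    (hK : IsCompact K) (hρ : ContDiff ℝ 2 ρ)
    (h : ∀ x ∈ K, gradient ρ x ≠ 0 ∧ ∃ t₀ : ℝ, ∀ t ≥ t₀,
      secondFF ρ x + t • projMat (innerNormal ρ x) ∈ Subtype.val '' interior F.carrier) :
    ∃ k : ℕ, ∀ x ∈ K, symHess ρ x + (k : ℝ) • symProj (gradient ρ x)
      - (2 / ((k : ℝ) + 1)) • (1 : SymMat n) ∈ interior F.carrier := by
  have hc : ∀ k : ℕ, Continuous fun x => symHess ρ x + (k : ℝ) • symProj (gradient ρ x)
      - (2 / ((k : ℝ) + 1)) • (1 : SymMat n) := by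
    intro k
    have h1 : Continuous (symHess ρ) :=
      continuous_iff_continuousAt.2 fun x => continuousAt_symHess hρ.contDiffAt
    have h2 := continuous_symProj.comp (continuous_gradient_of_contDiff hρ)
    exact (h1.add (h2.const_smul (k : ℝ))).sub continuous_const
  have hmono : ∀ x, ∀ s s' δ δ' : ℝ, s ≤ s' → δ' ≤ δ →
      symHess ρ x + s • symProj (gradient ρ x) - δ • (1 : SymMat n) ∈ interior F.carrier →
      symHess ρ x + s' • symProj (gradient ρ x) - δ' • (1 : SymMat n) ∈ interior F.carrier := by
    intro x s s' δ δ' hs hδ hm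
    have hP : SymPSD ((s' - s) • symProj (gradient ρ x) + (δ - δ') • (1 : SymMat n)) := by
      intro v
      rw [symQuad_add]
      exact add_nonneg ((symPSD_symProj _).smul (sub_nonneg.2 hs) v)
        (symPSD_one.smul (sub_nonneg.2 hδ) v)
    have := F.interior_add_psd hm hP
    convert this using 1
    module
  have hle : ∀ k l : ℕ, k ≤ l → 2 / ((l : ℝ) + 1) ≤ 2 / ((k : ℝ) + 1) := fun k l hkl => by
    have : (k : ℝ) ≤ l := Nat.cast_le.2 hkl
    gcongr
  refine hK.elim_directed_cover (fun k : ℕ => {x | symHess ρ x + (k : ℝ) • symProj (gradient ρ x)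
      - (2 / ((k : ℝ) + 1)) • (1 : SymMat n) ∈ interior F.carrier})
    (fun k => isOpen_interior.preimage (hc k)) ?_ ?_
  · intro x hx
    obtain ⟨hg, t₀, ht₀⟩ := h x hx
    obtain ⟨s₀, hs₀⟩ := exists_symHess_add_mem_interior hρ.contDiffAt hg (ht₀ t₀ le_rfl)
    obtain ⟨δ, hδ, hm⟩ := F.exists_sub_smul_one_mem (hs₀ s₀ le_rfl)
    obtain ⟨k, hk⟩ := exists_nat_ge (max s₀ (2 / δ))
    refine Set.mem_iUnion.2 ⟨k, hmono x s₀ k δ _ ((le_max_left _ _).trans hk) ?_ hm⟩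
    have h2 := (le_max_right _ _).trans hk
    rw [div_le_iff₀ hδ] at h2
    rw [div_le_iff₀ (by positivity)]
    linarith
  · refine directed_of_isDirected_le fun k l hkl x hx => ?_
    exact hmono x k l _ _ (Nat.cast_le.2 hkl) (hle k l hkl) hx

/-- A strictly subharmonic barrier vanishing on the boundary. -/
lemma exists_barrier {F : ConeSubequation n} {Ω : Set (EucSp n)} (hΩ : IsOpen Ω)
    (hΩb : Bornology.IsBounded Ω) (hbdry : StrictlyConvexBoundary F Ω) :
    ∃ (κ : ℝ) (σ : EucSp n → ℝ), 0 < κ ∧ ContinuousOn σ (closure Ω) ∧ ViscOn F.carrier Ω σ ∧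
      (∀ x ∈ frontier Ω, σ x + κ * ‖x - 0‖ ^ 2 = 0) ∧ ∀ x ∈ Ω, σ x + κ * ‖x - 0‖ ^ 2 < 0 := by
  obtain ⟨ρ, hρs, hΩρ, hfr⟩ := hbdry
  have hρ : ContDiff ℝ 2 ρ := contDiff_infty.1 hρs 2
  have hneg : ∀ x ∈ Ω, ρ x < 0 := fun x hx => by rw [hΩρ] at hx; exact hx
  have hzero : ∀ x ∈ frontier Ω, ρ x = 0 := by
    intro x hx
    rw [hΩ.frontier_eq] at hx
    refine le_antisymm ?_ ?_
    · exact closure_minimal (fun y hy => (hneg y hy).le)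
        (isClosed_le hρ.continuous continuous_const) hx.1
    · by_contra! hlt
      exact hx.2 (by rw [hΩρ]; exact hlt)
  have hnonpos : ∀ x ∈ closure Ω, ρ x ≤ 0 := fun x hx =>
    closure_minimal (fun y hy => (hneg y hy).le) (isClosed_le hρ.continuous continuous_const) hx
  have hCc : IsCompact (closure Ω) := hΩb.isCompact_closure
  have hFc : IsCompact (frontier Ω) := hCc.of_isClosed_subset isClosed_frontier frontier_subset_closure
  obtain ⟨k, hk⟩ := exists_forall_frontier_symHess hFc hρ hfr
  set ρ₁ : EucSp n → ℝ := fun y => ρ y + (k / 2 : ℝ) * (ρ y * ρ y)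
  have hρ₁ : ContDiff ℝ 2 ρ₁ := hρ.add (contDiff_const.mul (hρ.mul hρ))
  set δ : ℝ := 2 / ((k : ℝ) + 1) with hδdef
  have hδ : 0 < δ := by positivity
  set N : Set (EucSp n) := {x | symHess ρ₁ x - δ • (1 : SymMat n) ∈ interior F.carrier ∧
    -1 / ((k : ℝ) + 1) < ρ x}
  have hNo : IsOpen N := by
    refine IsOpen.and ?_ (isOpen_lt continuous_const hρ.continuous)
    have h1 : Continuous (symHess ρ₁) :=
      continuous_iff_continuousAt.2 fun x => continuousAt_symHess hρ₁.contDiffAt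
    exact isOpen_interior.preimage (h1.sub continuous_const)
  have hfN : frontier Ω ⊆ N := by
    intro x hx
    refine ⟨?_, ?_⟩
    · have h1 := hk x hx
      have h2 : symHess ρ₁ x = symHess ρ x + (k : ℝ) • symProj (gradient ρ x) := by
        rw [symHess_add_smul hρ.contDiffAt (hρ.mul hρ).contDiffAt, symHess_mul_self hρ.contDiffAt,
          hzero x hx]
        module
      rwa [h2]
    · rw [hzero x hx]
      exact div_neg_of_neg_of_pos (by norm_num) (by positivity)
  obtain ⟨η, hη, hηN⟩ : ∃ η > 0, ∀ x ∈ closure Ω, x ∉ N → ρ x ≤ -η := by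
    have hc : IsCompact (closure Ω \ N) := hCc.diff hNo
    rcases (closure Ω \ N).eq_empty_or_nonempty with he | hne
    · exact ⟨1, one_pos, fun x hx hxN => (Set.eq_empty_iff_forall_notMem.1 he x ⟨hx, hxN⟩).elim⟩
    · obtain ⟨z, hz, hmax⟩ := hc.exists_isMaxOn hne hρ.continuous.continuousOn
      refine ⟨-ρ z, ?_, fun x hx hxN => ?_⟩
      · have := hneg z (mem_of_mem_closure_of_notMem_frontier hΩ hz.1 fun h => hz.2 (hfN h))
        linarith
      · have := hmax ⟨hx, hxN⟩
        simpa using this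
  obtain ⟨R, hR⟩ := hCc.isBounded.exists_norm_le
  have hRsq : ∀ x ∈ closure Ω, ‖x - 0‖ ^ 2 ≤ R ^ 2 := fun x hx => by
    rw [sub_zero]
    exact pow_le_pow_left₀ (norm_nonneg _) (hR x hx) 2
  set κ : ℝ := min (δ / 2) (η / 8 / (R ^ 2 + 1)) with hκdef
  have hκ : 0 < κ := lt_min (by positivity) (by positivity)
  have hκR : ∀ x ∈ closure Ω, κ * ‖x - 0‖ ^ 2 < η / 4 := by
    intro x hx
    have h1 : κ * (R ^ 2 + 1) ≤ η / 8 := by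
      rw [← le_div_iff₀ (by positivity)]; exact min_le_right _ _
    nlinarith [hRsq x hx]
  have hhalf : ∀ x ∈ N, ρ x ≤ 0 → ρ₁ x ≤ ρ x / 2 := by
    intro x hx hx0
    have h1 : -1 < (k : ℝ) * ρ x := by
      have := hx.2
      rw [div_lt_iff₀ (by positivity)] at this
      linarith
    show ρ x + (k / 2 : ℝ) * (ρ x * ρ x) ≤ ρ x / 2
    nlinarith
  set w : EucSp n → ℝ := fun y => ρ₁ y + (-κ) * ‖y - 0‖ ^ 2
  have hq := contDiff_norm_sub_sq (n := n) 0
  have hwc : ContDiff ℝ 2 w := hρ₁.add (contDiff_const.mul hq)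
  refine ⟨κ, glueMax N (fun _ => -(η / 4)) w, hκ, ?_, ?_, ?_, ?_⟩
  · refine continuousOn_glueMax (K := {x | x ∈ closure Ω ∧ -(η / 2) ≤ ρ x}) hNo continuousOn_const
      hwc.continuous.continuousOn
      (isClosed_closure.inter (isClosed_le continuous_const hρ.continuous)) ?_ ?_
    · rintro x ⟨hx, hxρ⟩
      by_contra hxN
      linarith [hηN x hx hxN]
    · rintro x ⟨hxN, hx⟩ hxK
      have h1 : ρ x < -(η / 2) := by
        by_contra! h
        exact hxK ⟨hx, h⟩
      have h2 := hhalf x hxN (hnonpos x hx)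
      have h3 : 0 ≤ κ * ‖x - 0‖ ^ 2 := by positivity
      show ρ₁ x + (-κ) * ‖x - 0‖ ^ 2 ≤ -(η / 4)
      linarith
  · refine ViscOn.glueMax hNo ?_ ?_
    · refine ViscOn.of_contDiffAt (fun A hA P hP => F.add_psd_mem hA hP)
        (fun _ _ => contDiffAt_const) fun x _ => ?_
      rw [symHess_const]
      exact F.zero_mem
    · refine ViscOn.of_contDiffAt (fun A hA P hP => F.add_psd_mem hA hP)
        (fun _ _ => hwc.contDiffAt) fun x hx => ?_
      rw [symHess_add_smul hρ₁.contDiffAt hq.contDiffAt, symHess_norm_sub_sq]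
      have h1 := F.add_psd_mem (interior_subset hx.1)
        (symPSD_one.smul (c := δ - 2 * κ) (by linarith [min_le_left (δ / 2) (η / 8 / (R ^ 2 + 1))]))
      convert h1 using 1
      module
  · intro x hx
    have hxC := frontier_subset_closure hx
    rw [glueMax, if_pos (hfN hx), max_eq_right]
    · simp [w, ρ₁, hzero x hx]
    · have := hκR x hxC
      simp only [w, ρ₁, hzero x hx]
      linarith
  · intro x hx
    have hxC := subset_closure hx
    have h1 := hκR x hxC
    rw [glueMax]
    split_ifs with hxN
    · have h2 := hhalf x hxN (hneg x hx).le
      have h3 := hneg x hx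
      rcases max_cases (-(η / 4)) (w x) with ⟨h, -⟩ | ⟨h, -⟩ <;> rw [h]
      · linarith
      · show ρ₁ x + (-κ) * ‖x - 0‖ ^ 2 + κ * ‖x - 0‖ ^ 2 < 0
        linarith
    · linarith

lemma ViscOn.of_forall_abs_sub_le {S : Set (SymMat n)} {X : Set (EucSp n)} {u : EucSp n → ℝ}
    (hS : IsClosed S) (hX : IsOpen X)
    (h : ∀ ε > 0, ∃ v : EucSp n → ℝ, ContinuousOn v X ∧ ViscOn S X v ∧ ∀ x ∈ X, |v x - u x| ≤ ε) :
    ViscOn S X u := by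
  refine ViscOn.of_approx hS fun z hz => ?_
  obtain ⟨r, hr, hrX⟩ := Metric.nhds_basis_closedBall.mem_iff.1 (hX.mem_nhds hz)
  refine ⟨r, hr, fun ε hε => ?_⟩
  obtain ⟨v, hvc, hv, hvu⟩ := h ε hε
  refine ⟨v, hvc.mono hrX, hv.mono (Metric.ball_subset_closedBall.trans hrX), fun x hx => ?_, ?_⟩
  · linarith [(abs_le.1 (hvu x (hrX hx))).2]
  · linarith [(abs_le.1 (hvu z hz)).1]

lemma exists_forall_symPSD_add {K : Set (EucSp n)} (hK : IsCompact K) {p : EucSp n → ℝ}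
    (hp : ContDiff ℝ 2 p) :
    ∃ C : ℝ, 0 ≤ C ∧ ∀ c ≥ C, ∀ x ∈ K, SymPSD (symHess p x + c • (1 : SymMat n)) := by
  have h1 : Continuous (symHess p) :=
    continuous_iff_continuousAt.2 fun x => continuousAt_symHess hp.contDiffAt
  have hc : Continuous fun x => ∑ i, ∑ j, |(symHess p x).1 i j| :=
    continuous_finsetSum _ fun i _ => continuous_finsetSum _ fun j _ =>
      ((continuous_symMat_entry i j).comp h1).abs
  obtain ⟨C, hC⟩ := hK.exists_bound_of_continuousOn hc.continuousOn
  refine ⟨max C 0, le_max_right _ _, fun c hc x hx v => ?_⟩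
  rw [symQuad_add, symQuad_smul, symQuad_one]
  have h2 := (abs_le.1 (abs_symQuad_le (symHess p x) v)).1
  have h3 := (le_abs_self _).trans ((hC x hx).trans ((le_max_left _ _).trans hc))
  nlinarith [sq_nonneg ‖v‖, mul_le_mul_of_nonneg_right h3 (sq_nonneg ‖v‖)]

section Dirichlet

variable {F : ConeSubequation n} {Ω : Set (EucSp n)} {κ : ℝ} {σ : EucSp n → ℝ}

lemma ViscOn.const_mul {X : Set (EucSp n)} {u : EucSp n → ℝ} (h : ViscOn F.carrier X u) {c : ℝ}
    (hc : 0 ≤ c) : ViscOn F.carrier X (fun x => c * u x) := by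
  rcases hc.eq_or_lt with rfl | hc
  · simp only [zero_mul]
    refine ViscOn.of_contDiffAt (fun A hA P hP => F.add_psd_mem hA hP)
      (fun _ _ => contDiffAt_const) fun x _ => ?_
    rw [symHess_const]
    exact F.zero_mem
  · simpa using h.const_mul_add hc (fun A hA => F.smul_mem hA hc.le) 0

/-- Adding a large multiple of the barrier to a smooth function gives a subsolution. -/
lemma exists_viscOn_add_barrier (hF : Convex ℝ F.carrier) (hΩb : Bornology.IsBounded Ω)
    (hκ : 0 < κ) (hσ : ViscOn F.carrier Ω σ) {p : EucSp n → ℝ} (hp : ContDiff ℝ 2 p) :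
    ∃ C₀ : ℝ, 0 ≤ C₀ ∧ ∀ C ≥ C₀,
      ViscOn F.carrier Ω (fun x => p x + C * (σ x + κ * ‖x - 0‖ ^ 2)) := by
  obtain ⟨C₀, hC₀, h⟩ := exists_forall_symPSD_add hΩb.isCompact_closure hp
  refine ⟨C₀ / (2 * κ), by positivity, fun C hC => ?_⟩
  have hC' : 0 ≤ C := le_trans (by positivity) hC
  have hq := contDiff_norm_sub_sq (n := n) 0
  have h1 := (hσ.const_mul hC').add_contDiffAt hF (w := fun x => p x + (C * κ) * ‖x - 0‖ ^ 2)
    (fun x _ => (hp.add (contDiff_const.mul hq)).contDiffAt) (fun x hx => ?_)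
  · convert h1 using 2
    ring
  · rw [symHess_add_smul hp.contDiffAt hq.contDiffAt, symHess_norm_sub_sq, smul_smul]
    refine F.psd_mem (h _ ?_ x (subset_closure hx))
    rw [ge_iff_le, div_le_iff₀ (by positivity)] at hC
    linarith

lemma exists_harmonic_of_contDiff (hF : Convex ℝ F.carrier) (hΩ : IsOpen Ω)
    (hΩb : Bornology.IsBounded Ω) (hκ : 0 < κ) (hσc : ContinuousOn σ (closure Ω))
    (hσ : ViscOn F.carrier Ω σ) (hσ0 : ∀ x ∈ frontier Ω, σ x + κ * ‖x - 0‖ ^ 2 = 0)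
    (hσn : ∀ x ∈ Ω, σ x + κ * ‖x - 0‖ ^ 2 < 0) {p : EucSp n → ℝ} (hp : ContDiff ℝ 2 p) :
    ∃ H : EucSp n → ℝ, ContinuousOn H (closure Ω) ∧ (∀ x ∈ frontier Ω, H x = p x) ∧
      ViscOn F.carrier Ω H ∧ ViscOn (dualSet F.carrier) Ω (fun x => -H x) := by
  obtain ⟨C₁, hC₁0, hC₁⟩ := exists_viscOn_add_barrier hF hΩb hκ hσ hp
  obtain ⟨C₂, hC₂0, hC₂⟩ := exists_viscOn_add_barrier hF hΩb hκ hσ hp.neg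
  set C := max C₁ C₂
  have hC0 : 0 ≤ C := hC₁0.trans (le_max_left _ _)
  have hbn : ∀ x ∈ closure Ω, σ x + κ * ‖x - 0‖ ^ 2 ≤ 0 := by
    intro x hx
    by_cases hf : x ∈ frontier Ω
    · exact (hσ0 x hf).le
    · exact (hσn x (mem_of_mem_closure_of_notMem_frontier hΩ hx hf)).le
  have hbc : ContinuousOn (fun x => σ x + κ * ‖x - 0‖ ^ 2) (closure Ω) :=
    hσc.add (continuousOn_const.mul (contDiff_norm_sub_sq 0).continuous.continuousOn)
  obtain ⟨H, hHc, hHb, hHF, hHd⟩ := exists_harmonic_between (F := F) hΩ hΩb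
    (g₁ := fun x => p x + C * (σ x + κ * ‖x - 0‖ ^ 2))
    (g₂ := fun x => p x - C * (σ x + κ * ‖x - 0‖ ^ 2))
    (hp.continuous.continuousOn.add (continuousOn_const.mul hbc))
    (hp.continuous.continuousOn.sub (continuousOn_const.mul hbc))
    (fun x hx => by nlinarith [hbn x hx])
    (fun x hx => by linarith [congrArg (C * ·) (hσ0 x hx)])
    (hC₁ C (le_max_left _ _))
    (by
      convert (hC₂ C (le_max_right _ _)).mono_set (F.subset_dualSet hF) using 2
      ring)
  refine ⟨H, hHc, fun x hx => ?_, hHF, hHd⟩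
  have := hHb x (frontier_subset_closure hx)
  rw [hσ0 x hx, mul_zero, add_zero, sub_zero] at this
  exact le_antisymm this.2 this.1

/-- Solvability of the Dirichlet problem with continuous boundary data. -/
lemma exists_harmonic_of_continuousOn (hF : Convex ℝ F.carrier) (hΩ : IsOpen Ω)
    (hΩb : Bornology.IsBounded Ω) (hκ : 0 < κ) (hσc : ContinuousOn σ (closure Ω))
    (hσ : ViscOn F.carrier Ω σ) (hσ0 : ∀ x ∈ frontier Ω, σ x + κ * ‖x - 0‖ ^ 2 = 0)
    (hσn : ∀ x ∈ Ω, σ x + κ * ‖x - 0‖ ^ 2 < 0) {φ : EucSp n → ℝ}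
    (hφ : ContinuousOn φ (frontier Ω)) :
    ∃ H : EucSp n → ℝ, ContinuousOn H (closure Ω) ∧ (∀ x ∈ frontier Ω, H x = φ x) ∧
      ViscOn F.carrier Ω H ∧ ViscOn (dualSet F.carrier) Ω (fun x => -H x) := by
  have hFc : IsCompact (frontier Ω) :=
    hΩb.isCompact_closure.of_isClosed_subset isClosed_frontier frontier_subset_closure
  have hpos : ∀ k : ℕ, (0 : ℝ) < 1 / ((k : ℝ) + 1) := fun k => Nat.one_div_pos_of_nat
  choose p hp using fun k : ℕ => exists_polyFun_near hFc hφ (hpos k)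
  choose u huc hup huF hud using fun k =>
    exists_harmonic_of_contDiff hF hΩ hΩb hκ hσc hσ hσ0 hσn (contDiff_polyFun (p k))
  have huφ : ∀ k, ∀ x ∈ frontier Ω, |u k x - φ x| ≤ 1 / ((k : ℝ) + 1) := fun k x hx => by
    rw [hup k x hx]; exact hp k x hx
  have hsub : ∀ k l, ∀ x ∈ closure Ω, u k x - u l x ≤ 1 / ((k : ℝ) + 1) + 1 / ((l : ℝ) + 1) :=
    fun k l => comparison_le hF hΩ hΩb (huc k) (huc l) (huF k) (hud l) fun x hx => by
      linarith [(abs_le.1 (huφ k x hx)).2, (abs_le.1 (huφ l x hx)).1]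
  have hlim0 : Tendsto (fun k : ℕ => 1 / ((k : ℝ) + 1)) atTop (𝓝 0) :=
    tendsto_one_div_add_atTop_nhds_zero_nat
  have hcau : ∀ x ∈ closure Ω, CauchySeq fun k => u k x := by
    intro x hx
    refine cauchySeq_of_le_tendsto_0' (fun k : ℕ => 1 / ((k : ℝ) + 1) + 1 / ((k : ℝ) + 1))
      (fun k l hkl => ?_) (by simpa using hlim0.add hlim0)
    have h1 : 1 / ((l : ℝ) + 1) ≤ 1 / ((k : ℝ) + 1) := Nat.one_div_le_one_div hkl
    rw [Real.dist_eq, abs_le]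
    constructor <;> linarith [hsub k l x hx, hsub l k x hx]
  have hex : ∀ x, ∃ a, x ∈ closure Ω → Tendsto (fun k => u k x) atTop (𝓝 a) := by
    intro x
    by_cases hx : x ∈ closure Ω
    · obtain ⟨a, ha⟩ := cauchySeq_tendsto_of_complete (hcau x hx)
      exact ⟨a, fun _ => ha⟩
    · exact ⟨0, fun h => (hx h).elim⟩
  choose H hH using hex
  have hunif : ∀ k, ∀ x ∈ closure Ω, |u k x - H x| ≤ 1 / ((k : ℝ) + 1) := by
    intro k x hx
    have h1 : Tendsto (fun l : ℕ => 1 / ((k : ℝ) + 1) + 1 / ((l : ℝ) + 1)) atTop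
        (𝓝 (1 / ((k : ℝ) + 1))) := by simpa using hlim0.const_add (1 / ((k : ℝ) + 1))
    refine abs_le.2 ⟨?_, ?_⟩
    · have := le_of_tendsto_of_tendsto' ((hH x hx).sub_const (u k x)) h1 fun l => by
        linarith [hsub l k x hx]
      linarith
    · exact le_of_tendsto_of_tendsto' ((hH x hx).const_sub (u k x)) h1 fun l => hsub k l x hx
  have happ : ∀ ε > 0, ∃ k, ∀ x ∈ closure Ω, |u k x - H x| ≤ ε := by
    intro ε hε
    obtain ⟨k, hk⟩ := exists_nat_one_div_lt hε
    exact ⟨k, fun x hx => (hunif k x hx).trans hk.le⟩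
  refine ⟨H, ?_, fun x hx => ?_, ?_, ?_⟩
  · have hU : TendstoUniformlyOn u H atTop (closure Ω) := by
      rw [Metric.tendstoUniformlyOn_iff]
      intro ε hε
      filter_upwards [hlim0.eventually (gt_mem_nhds hε)] with k hk x hx
      rw [dist_comm, Real.dist_eq]
      exact (hunif k x hx).trans_lt hk
    exact hU.continuousOn (Eventually.of_forall huc).frequently
  · refine tendsto_nhds_unique (hH x (frontier_subset_closure hx)) ?_
    rw [tendsto_iff_dist_tendsto_zero]
    exact squeeze_zero (fun _ => dist_nonneg) (fun k => huφ k x hx) hlim0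
  · refine ViscOn.of_forall_abs_sub_le F.isClosed' hΩ fun ε hε => ?_
    obtain ⟨k, hk⟩ := happ ε hε
    exact ⟨u k, (huc k).mono subset_closure, huF k, fun x hx => hk x (subset_closure hx)⟩
  · refine ViscOn.of_forall_abs_sub_le F.isClosed_dualSet hΩ fun ε hε => ?_
    obtain ⟨k, hk⟩ := happ ε hε
    refine ⟨fun x => -u k x, ((huc k).mono subset_closure).neg, hud k, fun x hx => ?_⟩
    have := hk x (subset_closure hx)
    rwa [← abs_neg, show -(-u k x - -H x) = u k x - H x by ring]

end Dirichlet

section Punctured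

variable {F : ConeSubequation n} {Ω : Set (EucSp n)} {x₀ : EucSp n}

lemma ConeSubequation.punctured_neBot (F : ConeSubequation n) (x : EucSp n) : (𝓝[≠] x).NeBot := by
  have : Nonempty (Fin n) := ⟨⟨0, F.dim_pos⟩⟩
  infer_instance

lemma closure_diff_singleton (F : ConeSubequation n) (hΩ : IsOpen Ω) :
    closure (Ω \ {x₀}) = closure Ω := by
  have := F.punctured_neBot x₀
  refine (closure_mono Set.sdiff_subset).antisymm (closure_minimal ?_ isClosed_closure)
  exact (dense_compl_singleton x₀).open_subset_closure_inter hΩ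

lemma comparison_punctured (hF : Convex ℝ F.carrier) (hΩ : IsOpen Ω)
    (hΩb : Bornology.IsBounded Ω) {u w v : EucSp n → ℝ} (hu : ContinuousOn u (closure Ω))
    (hw : ContinuousOn w (closure Ω)) (hv : ContinuousOn v (closure Ω))
    (huv : ViscOn F.carrier (Ω \ {x₀}) u) (hwv : ViscOn F.carrier (Ω \ {x₀}) w)
    (hvv : ViscOn (dualSet F.carrier) (Ω \ {x₀}) (fun x => -v x)) {α β M : ℝ} (hα : 0 ≤ α)
    (hβ : 0 ≤ β) (hle : ∀ x ∈ frontier Ω, α * u x + β * w x - v x ≤ M)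
    (hle₀ : α * u x₀ + β * w x₀ - v x₀ ≤ M) :
    ∀ x ∈ closure Ω, α * u x + β * w x - v x ≤ M := by
  have hcl := closure_diff_singleton (x₀ := x₀) F hΩ
  have hX : IsOpen (Ω \ {x₀}) := hΩ.sdiff isClosed_singleton
  rw [← hcl] at hu hw hv ⊢
  refine comparison hF hX (hΩb.subset Set.sdiff_subset) hu hw hv huv hwv hvv hα hβ fun x hx => ?_
  by_cases hxx : x = x₀
  · rw [hxx]; exact hle₀
  · refine hle x ?_
    rw [hX.frontier_eq, hcl] at hx
    rw [hΩ.frontier_eq]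
    exact ⟨hx.1, fun h => hx.2 ⟨h, hxx⟩⟩

/-- Functions that are continuous up to the boundary and harmonic away from a point. -/
structure PuncturedHarmonic (F : ConeSubequation n) (Ω : Set (EucSp n)) (x₀ : EucSp n)
    (H : EucSp n → ℝ) : Prop where
  cont : ContinuousOn H (closure Ω)
  sub : ViscOn F.carrier (Ω \ {x₀}) H
  sup : ViscOn (dualSet F.carrier) (Ω \ {x₀}) (fun x => -H x)

/-- The density of `H` relative to `h` at `x₀`. -/
def HasDensity (h : EucSp n → ℝ) (x₀ : EucSp n) (H : EucSp n → ℝ) (Θ : ℝ) : Prop :=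
  Tendsto (fun y => (H y - H x₀) / h y) (𝓝[≠] x₀) (𝓝 Θ)

namespace PuncturedHarmonic

variable {u v h : EucSp n → ℝ}

lemma fharmonicOn (hu : PuncturedHarmonic F Ω x₀ u) (hΩ : IsOpen Ω) :
    FHarmonicOn F (Ω \ {x₀}) (fun y => (u y : EReal)) :=
  fharmonicOn_of_viscOn (hΩ.sdiff isClosed_singleton)
    (hu.cont.mono (Set.sdiff_subset.trans subset_closure)) hu.sub hu.sup

lemma eqOn (hF : Convex ℝ F.carrier) (hΩ : IsOpen Ω) (hΩb : Bornology.IsBounded Ω)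
    (hu : PuncturedHarmonic F Ω x₀ u) (hv : PuncturedHarmonic F Ω x₀ v)
    (huv : ∀ x ∈ frontier Ω, u x = v x) (h₀ : u x₀ = v x₀) : Set.EqOn u v (closure Ω) := by
  intro x hx
  have h1 := comparison_punctured hF hΩ hΩb hu.cont hu.cont hv.cont hu.sub hu.sub hv.sup
    (α := 1) (β := 0) (M := 0) zero_le_one le_rfl
    (fun y hy => by rw [huv y hy]; linarith) (by rw [h₀]; linarith) x hx
  have h2 := comparison_punctured hF hΩ hΩb hv.cont hv.cont hu.cont hv.sub hv.sub hu.sup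
    (α := 1) (β := 0) (M := 0) zero_le_one le_rfl
    (fun y hy => by rw [huv y hy]; linarith) (by rw [h₀]; linarith) x hx
  linarith

/-- Lowering the value at the singular point by `c` forces growth at least `c * h`. -/
lemma add_mul_le (hF : Convex ℝ F.carrier) (hΩ : IsOpen Ω) (hΩb : Bornology.IsBounded Ω)
    (hh : PuncturedHarmonic F Ω x₀ h) (h0 : h x₀ = 0) (h1 : ∀ x ∈ frontier Ω, h x ≤ 1)
    (hu : PuncturedHarmonic F Ω x₀ u) (hv : PuncturedHarmonic F Ω x₀ v)
    (huv : ∀ x ∈ frontier Ω, u x = v x) {c : ℝ} (hc : 0 ≤ c) (h₀ : u x₀ = v x₀ + c) :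
    ∀ x ∈ closure Ω, u x + c * h x ≤ v x + c := by
  intro x hx
  have := comparison_punctured hF hΩ hΩb hu.cont hh.cont hv.cont hu.sub hh.sub hv.sup
    (α := 1) (β := c) (M := c) zero_le_one hc
    (fun y hy => by rw [huv y hy]; nlinarith [h1 y hy]) (by rw [h₀, h0]; linarith) x hx
  linarith

end PuncturedHarmonic

lemma HasDensity.le_of_eventually_le {h u v : EucSp n → ℝ} {a b c : ℝ} (F : ConeSubequation n)
    (hu : HasDensity h x₀ u a) (hv : HasDensity h x₀ v b) (hpos : ∀ᶠ y in 𝓝[≠] x₀, 0 < h y)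
    (hle : ∀ᶠ y in 𝓝[≠] x₀, u y - u x₀ + c * h y ≤ v y - v x₀) : a + c ≤ b := by
  have := F.punctured_neBot x₀
  refine le_of_tendsto_of_tendsto (hu.add_const c) hv ?_
  filter_upwards [hpos, hle] with y hy hyle
  rw [le_div_iff₀ hy, add_mul, div_mul_cancel₀ _ hy.ne']
  exact hyle

end Punctured

section Existence

variable {F : ConeSubequation n} {Ω : Set (EucSp n)} {x₀ : EucSp n} {κ : ℝ}
  {σ h H₀ : EucSp n → ℝ}

/-- A punctured harmonic function with given boundary values and a lowered value at `x₀`. -/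
lemma exists_puncturedHarmonic_sub (hF : Convex ℝ F.carrier) (hΩ : IsOpen Ω)
    (hΩb : Bornology.IsBounded Ω) (hx₀ : x₀ ∈ Ω) (hκ : 0 < κ) (hσc : ContinuousOn σ (closure Ω))
    (hσ : ViscOn F.carrier Ω σ) (hσ0 : ∀ x ∈ frontier Ω, σ x + κ * ‖x - 0‖ ^ 2 = 0)
    (hσn : ∀ x ∈ Ω, σ x + κ * ‖x - 0‖ ^ 2 < 0)
    (hh : PuncturedHarmonic F Ω x₀ h) (h0 : h x₀ = 0) (hpos : ∀ y ∈ closure Ω, y ≠ x₀ → 0 < h y)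
    (hH : ContinuousOn H₀ (closure Ω)) (hHF : ViscOn F.carrier Ω H₀)
    (hHd : ViscOn (dualSet F.carrier) Ω (fun x => -H₀ x)) {c : ℝ} (hc : 0 < c) :
    ∃ H : EucSp n → ℝ, PuncturedHarmonic F Ω x₀ H ∧ (∀ x ∈ frontier Ω, H x = H₀ x) ∧
      H x₀ = H₀ x₀ - c ∧ ∀ x ∈ closure Ω, H x ≤ H₀ x := by
  have hcl := closure_diff_singleton (x₀ := x₀) F hΩ
  have hX : IsOpen (Ω \ {x₀}) := hΩ.sdiff isClosed_singleton
  have hq := contDiff_norm_sub_sq (n := n) 0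
  set b : EucSp n → ℝ := fun x => σ x + κ * ‖x - 0‖ ^ 2
  have hb₀ : 0 < -b x₀ := neg_pos.2 (hσn x₀ hx₀)
  have hbn : ∀ x ∈ closure Ω, b x ≤ 0 := by
    intro x hx
    by_cases hf : x ∈ frontier Ω
    · exact (hσ0 x hf).le
    · exact (hσn x (mem_of_mem_closure_of_notMem_frontier hΩ hx hf)).le
  have hbc : ContinuousOn b (closure Ω) :=
    hσc.add (continuousOn_const.mul hq.continuous.continuousOn)
  have hbF : ViscOn F.carrier Ω b := by
    have h1 := hσ.add_contDiffAt hF (w := fun x => κ * ‖x - 0‖ ^ 2)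
      (fun x _ => (contDiff_const.mul hq).contDiffAt) (fun x _ => by
        rw [symHess_const_mul hq.contDiffAt, symHess_norm_sub_sq]
        exact F.psd_mem ((symPSD_one.smul zero_le_two).smul hκ.le))
    convert h1 using 2
    ring
  set C : ℝ := c / (-b x₀)
  have hC : 0 < C := div_pos hc hb₀
  have hCb : C * b x₀ = -c := by
    have : C * (-b x₀) = c := div_mul_cancel₀ _ hb₀.ne'
    linarith
  set g₁ : EucSp n → ℝ := fun x => H₀ x + C * b x
  have hg₁c : ContinuousOn g₁ (closure Ω) := hH.add (continuousOn_const.mul hbc)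
  have hg₁F : ViscOn F.carrier (Ω \ {x₀}) g₁ :=
    (ViscOn.add hF hΩ (hH.mono subset_closure) ((continuousOn_const.mul hbc).mono subset_closure)
      hHF (hbF.const_mul hC.le)).mono Set.sdiff_subset
  have hg₁₀ : g₁ x₀ = H₀ x₀ - c := by
    show H₀ x₀ + C * b x₀ = _
    rw [hCb]; ring
  have hg₁f : ∀ x ∈ frontier Ω, g₁ x = H₀ x := fun x hx => by
    show H₀ x + C * b x = H₀ x
    rw [show b x = 0 from hσ0 x hx]; ring
  have hx₀f : x₀ ∉ frontier Ω := fun hf => by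
    rw [hΩ.frontier_eq] at hf
    exact hf.2 hx₀
  obtain ⟨C', hC', hfr⟩ : ∃ C' > 0, ∀ x ∈ frontier Ω, H₀ x ≤ C' * h x + (H₀ x₀ - c) := by
    have hFc : IsCompact (frontier Ω) :=
      hΩb.isCompact_closure.of_isClosed_subset isClosed_frontier frontier_subset_closure
    have hhpos : ∀ x ∈ frontier Ω, 0 < h x := fun x hx =>
      hpos x (frontier_subset_closure hx) fun he => hx₀f (he ▸ hx)
    have hcq : ContinuousOn (fun x => (H₀ x - (H₀ x₀ - c)) / h x) (frontier Ω) :=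
      ((hH.mono frontier_subset_closure).sub continuousOn_const).div
        (hh.cont.mono frontier_subset_closure) fun x hx => (hhpos x hx).ne'
    obtain ⟨B, hB⟩ := hFc.exists_bound_of_continuousOn hcq
    refine ⟨max B 1, lt_max_of_lt_right one_pos, fun x hx => ?_⟩
    have h1 := (le_abs_self _).trans ((hB x hx).trans (le_max_left B 1))
    rw [div_le_iff₀ (hhpos x hx)] at h1
    linarith
  set k : EucSp n → ℝ := fun x => C' * h x + (H₀ x₀ - c)
  have hkc : ContinuousOn k (closure Ω) := (continuousOn_const.mul hh.cont).add continuousOn_const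
  have hkd : ViscOn (dualSet F.carrier) (Ω \ {x₀}) (fun x => -k x) := by
    have h1 := hh.sup.const_mul_add hC' (fun A hA => F.dualSet_smul_mem hA hC') (-(H₀ x₀ - c))
    convert h1 using 2
    simp only [k]
    ring
  have hk₀ : k x₀ = H₀ x₀ - c := by simp [k, h0]
  have hg₁k : ∀ x ∈ closure Ω, g₁ x ≤ k x := by
    intro x hx
    have := comparison_punctured hF hΩ hΩb hg₁c hg₁c hkc hg₁F hg₁F hkd
      (α := 1) (β := 0) (M := 0) zero_le_one le_rfl
      (fun y hy => by rw [hg₁f y hy]; linarith [hfr y hy]) (by rw [hg₁₀, hk₀]; linarith) x hx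
    linarith
  have hg₁H : ∀ x ∈ closure Ω, g₁ x ≤ H₀ x := fun x hx => by
    show H₀ x + C * b x ≤ H₀ x
    nlinarith [hbn x hx]
  have hmd : ViscOn (dualSet F.carrier) (Ω \ {x₀}) (fun x => -min (H₀ x) (k x)) := by
    refine (ViscOn.glueMax hX (hHd.mono Set.sdiff_subset) hkd).congr hX fun x hx => ?_
    rw [glueMax, if_pos hx, max_neg_neg]
  obtain ⟨H, hHc, hHb, hHsub, hHsup⟩ := exists_harmonic_between (F := F) hX
    (hΩb.subset Set.sdiff_subset) (g₁ := g₁) (g₂ := fun x => min (H₀ x) (k x))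
    (by rwa [hcl]) (by rw [hcl]; exact hH.inf hkc)
    (by rw [hcl]; exact fun x hx => le_min (hg₁H x hx) (hg₁k x hx))
    (by
      intro x hx
      by_cases hxx : x = x₀
      · rw [hxx, hg₁₀, hk₀, min_eq_right (by linarith)]
      · have hxf : x ∈ frontier Ω := by
          rw [hX.frontier_eq, hcl] at hx
          rw [hΩ.frontier_eq]
          exact ⟨hx.1, fun h => hx.2 ⟨h, hxx⟩⟩
        rw [hg₁f x hxf, min_eq_left (hfr x hxf)])
    hg₁F
    hmd
  rw [hcl] at hHc hHb
  refine ⟨H, ⟨hHc, hHsub, hHsup⟩, fun x hx => ?_, ?_, fun x hx =>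
    (hHb x hx).2.trans (min_le_left _ _)⟩
  · have h1 := hHb x (frontier_subset_closure hx)
    exact le_antisymm (h1.2.trans (min_le_left _ _)) ((hg₁f x hx).ge.trans h1.1)
  · have h1 := hHb x₀ (subset_closure hx₀)
    exact le_antisymm (h1.2.trans ((min_le_right _ _).trans hk₀.le)) (hg₁₀.ge.trans h1.1)

end Existence

section Density

variable {F : ConeSubequation n} {Ω : Set (EucSp n)} {x₀ : EucSp n} {h u H₀ : EucSp n → ℝ}

/-- Growth at least that of a positive multiple of `h` rules out test functions at `x₀`. -/
lemma ViscOn.of_mul_le {S : Set (SymMat n)} (hnotest : NoTestAt Ω (fun y => (h y : EReal)) x₀)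
    (h0 : h x₀ = 0) (hu : ViscOn S (Ω \ {x₀}) u) {c : ℝ} (hc : 0 < c)
    (hle : ∀ᶠ y in 𝓝 x₀, u x₀ + c * h y ≤ u y) : ViscOn S Ω u := by
  intro x hx ψ h1 h2 h3
  by_cases hxx : x = x₀
  · subst hxx
    refine (hnotest (fun y => c⁻¹ * (ψ y - u x)) ⟨contDiffAt_const.mul (h1.sub contDiffAt_const),
      mem_nhdsWithin_of_mem_nhds ?_, ?_⟩).elim
    · filter_upwards [hle, h2] with y hy1 hy2
      refine EReal.coe_le_coe_iff.2 ?_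
      rw [inv_mul_eq_div, le_div_iff₀ hc]
      linarith
    · simp [h0, h3]
  · exact hu x ⟨hx, hxx⟩ ψ h1 h2 h3

lemma eventually_pos (hΩ : IsOpen Ω) (hx₀ : x₀ ∈ Ω)
    (hpos : ∀ y ∈ closure Ω, y ≠ x₀ → 0 < h y) : ∀ᶠ y in 𝓝[≠] x₀, 0 < h y := by
  filter_upwards [self_mem_nhdsWithin, mem_nhdsWithin_of_mem_nhds (hΩ.mem_nhds hx₀)] with y hy hyΩ
    using hpos y (subset_closure hyΩ) hy

lemma HasDensity.eventually_abs_sub_le (hH : HasDensity h x₀ H₀ 0) (h0 : h x₀ = 0)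
    (hpos : ∀ᶠ y in 𝓝[≠] x₀, 0 < h y) {ε : ℝ} (hε : 0 < ε) :
    ∀ᶠ y in 𝓝 x₀, |H₀ y - H₀ x₀| ≤ ε * h y := by
  have h1 : ∀ᶠ y in 𝓝[≠] x₀, |H₀ y - H₀ x₀| ≤ ε * h y := by
    have := (tendsto_zero_iff_abs_tendsto_zero _).1 hH
    filter_upwards [this.eventually (gt_mem_nhds hε), hpos] with y hy hyp
    simp only [Function.comp, abs_div, abs_of_pos hyp] at hy
    rw [div_lt_iff₀ hyp] at hy
    exact hy.le
  rw [eventually_nhdsWithin_iff] at h1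
  filter_upwards [h1] with y hy
  by_cases hyx : y = x₀
  · simp [hyx, h0]
  · exact hy hyx

/-- Slightly lowered solutions have small density. -/
lemma exists_density_le (hF : Convex ℝ F.carrier) (hΩ : IsOpen Ω) (hx₀ : x₀ ∈ Ω)
    (hh : PuncturedHarmonic F Ω x₀ h) (h0 : h x₀ = 0) (hpos : ∀ y ∈ closure Ω, y ≠ x₀ → 0 < h y)
    (hH : HasDensity h x₀ H₀ 0) {ε : ℝ} (hε : 0 < ε) :
    ∃ c > 0, ∀ u θ, PuncturedHarmonic F Ω x₀ u → u x₀ = H₀ x₀ - c →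
      (∀ x ∈ closure Ω, u x ≤ H₀ x) → HasDensity h x₀ u θ → θ ≤ ε := by
  have hposn := eventually_pos hΩ hx₀ hpos
  obtain ⟨R, hR, hball⟩ := Metric.eventually_nhds_iff_ball.1
    ((hH.eventually_abs_sub_le h0 hposn (half_pos hε)).and (hΩ.mem_nhds hx₀))
  set r := R / 2
  have hr : 0 < r := half_pos hR
  have hcb : Metric.closedBall x₀ r ⊆ Metric.ball x₀ R := Metric.closedBall_subset_ball (half_lt_self hR)
  have hBΩ : Metric.ball x₀ r ⊆ Ω := fun y hy => (hball y (hcb (Metric.ball_subset_closedBall hy))).2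
  have hfB : frontier (Metric.ball x₀ r) = Metric.sphere x₀ r := frontier_ball x₀ hr.ne'
  have hsB : ∀ y ∈ Metric.sphere x₀ r, y ∈ Metric.ball x₀ R := fun y hy =>
    hcb (Metric.sphere_subset_closedBall hy)
  have hhs : ∀ y ∈ Metric.sphere x₀ r, 0 < h y := fun y hy =>
    hpos y (subset_closure (hball y (hsB y hy)).2) (Metric.ne_of_mem_sphere hy hr.ne')
  obtain ⟨m, hm, hmh⟩ : ∃ m > 0, ∀ y ∈ Metric.sphere x₀ r, m ≤ h y := by
    rcases (Metric.sphere x₀ r).eq_empty_or_nonempty with he | hne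
    · exact ⟨1, one_pos, by simp [he]⟩
    · obtain ⟨z, hz, hmin⟩ := (isCompact_sphere x₀ r).exists_isMinOn hne
        (hh.cont.mono fun y hy => subset_closure (hball y (hsB y hy)).2)
      exact ⟨h z, hhs z hz, fun y hy => hmin hy⟩
  refine ⟨ε / 2 * m, by positivity, fun u θ hu hu₀ huH hθ => ?_⟩
  have hsub : Metric.ball x₀ r \ {x₀} ⊆ Ω \ {x₀} := Set.sdiff_subset_sdiff_left hBΩ
  have hεd : ViscOn (dualSet F.carrier) (Metric.ball x₀ r \ {x₀}) (fun x => -(ε * h x)) := by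
    have h1 := (hh.sup.mono hsub).const_mul_add hε (fun A hA => F.dualSet_smul_mem hA hε) 0
    convert h1 using 2
    ring
  have hcm : closure (Metric.ball x₀ r) ⊆ closure Ω := closure_mono hBΩ
  have hcmp := comparison_punctured (x₀ := x₀) hF Metric.isOpen_ball Metric.isBounded_ball
    (v := fun x => ε * h x) (hu.cont.mono hcm) (hu.cont.mono hcm)
    (continuousOn_const.mul (hh.cont.mono hcm))
    (hu.sub.mono hsub) (hu.sub.mono hsub) hεd (α := 1) (β := 0) (M := u x₀) zero_le_one le_rfl
    (fun y hy => by
      rw [hfB] at hy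
      have hyb := hball y (hsB y hy)
      have h1 := huH y (subset_closure hyb.2)
      have h2 := (abs_le.1 hyb.1).2
      have h3 := mul_le_mul_of_nonneg_left (hmh y hy) (half_pos hε).le
      linarith) (by rw [h0]; linarith)
  have := F.punctured_neBot x₀
  refine le_of_tendsto hθ ?_
  filter_upwards [hposn, mem_nhdsWithin_of_mem_nhds (Metric.ball_mem_nhds x₀ hr)] with y hy hyb
  rw [div_le_iff₀ hy]
  linarith [hcmp y (subset_closure hyb)]

end Density

/-- Theorem 7.4, existence and uniqueness for a prescribed density: for a
convex cone subequation satisfying (F3), with hypotheses (H1), (H3), (H4) on the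
finite-type singularity h, the Dirichlet problem with any prescribed h-density Θ ≥ 0 and
boundary values φ is uniquely solvable. -/
theorem dirichlet_singularities_stmt13 {n : ℕ} (F : ConeSubequation n)
    (hconv : Convex ℝ F.carrier) (hF3 : CondF3 F)
    (Ω : Set (EucSp n)) (hΩ : IsBoundedDomain Ω) (hbdry : StrictlyConvexBoundary F Ω)
    (x₀ : EucSp n) (hx₀ : x₀ ∈ Ω)
    -- Hypothesis (H1), normalized:
    (h : EucSp n → ℝ) (hhc : ContinuousOn h (closure Ω))
    (hharm : FHarmonicOn F (Ω \ {x₀}) (fun y => (h y : EReal)))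
    (hnotest : NoTestAt Ω (fun y => (h y : EReal)) x₀)
    (h0 : h x₀ = 0) (hpos : ∀ y ∈ closure Ω, y ≠ x₀ → 0 < h y)
    (hsup : sSup (h '' frontier Ω) = 1)
    -- Hypothesis (H3):
    (hH3 : ∀ H : EucSp n → ℝ, ∀ U : Set (EucSp n), IsOpen U → x₀ ∈ U →
      FSubharmonicOn F.carrier U (fun y => (H y : EReal)) →
      FHarmonicOn F (U \ {x₀}) (fun y => (H y : EReal)) →
      ∃ Θ : ℝ, 0 ≤ Θ ∧
        Filter.Tendsto (fun y => (H y - H x₀) / h y) (𝓝[≠] x₀) (𝓝 Θ))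
    -- Hypothesis (H4):
    (hH4 : ∀ H : EucSp n → ℝ, ∀ U : Set (EucSp n), IsOpen U → x₀ ∈ U →
      FHarmonicOn F U (fun y => (H y : EReal)) →
      Filter.Tendsto (fun y => (H y - H x₀) / h y) (𝓝[≠] x₀) (𝓝 0))
    (Θ : ℝ) (hΘ : 0 ≤ Θ) (φ : EucSp n → ℝ) (hφ : ContinuousOn φ (frontier Ω)) :
    ∃ H : EucSp n → ℝ,
      (ContinuousOn H (closure Ω) ∧
       FHarmonicOn F (Ω \ {x₀}) (fun y => (H y : EReal)) ∧
       (∀ y ∈ frontier Ω, H y = φ y) ∧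
       Filter.Tendsto (fun y => (H y - H x₀) / h y) (𝓝[≠] x₀) (𝓝 Θ)) ∧
      ∀ H' : EucSp n → ℝ,
        (ContinuousOn H' (closure Ω) ∧
         FHarmonicOn F (Ω \ {x₀}) (fun y => (H' y : EReal)) ∧
         (∀ y ∈ frontier Ω, H' y = φ y) ∧
         Filter.Tendsto (fun y => (H' y - H' x₀) / h y) (𝓝[≠] x₀) (𝓝 Θ)) →
        Set.EqOn H H' (closure Ω) := by
  obtain ⟨hΩo, -, hΩb⟩ := hΩ
  have hFc : IsCompact (frontier Ω) :=
    hΩb.isCompact_closure.of_isClosed_subset isClosed_frontier frontier_subset_closure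
  have hh : PuncturedHarmonic F Ω x₀ h := ⟨hhc, hharm.viscOn.1, hharm.viscOn.2⟩
  have hh1 : ∀ x ∈ frontier Ω, h x ≤ 1 := fun x hx => by
    rw [← hsup]
    exact le_csSup (hFc.bddAbove_image (hhc.mono frontier_subset_closure)) ⟨x, hx, rfl⟩
  have hposn := eventually_pos hΩo hx₀ hpos
  have hnhd : ∀ᶠ y in 𝓝[≠] x₀, y ∈ closure Ω :=
    mem_nhdsWithin_of_mem_nhds (mem_of_superset (hΩo.mem_nhds hx₀) subset_closure)
  have hval : ∀ u v, PuncturedHarmonic F Ω x₀ u → PuncturedHarmonic F Ω x₀ v →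
      (∀ y ∈ frontier Ω, u y = v y) → HasDensity h x₀ u Θ → HasDensity h x₀ v Θ →
      u x₀ ≤ v x₀ := by
    intro u v hu hv huv hud hvd
    by_contra! hlt
    have h1 := hh.add_mul_le hconv hΩo hΩb h0 hh1 hu hv huv (c := u x₀ - v x₀)
      (sub_nonneg.2 hlt.le) (by ring)
    have h2 := HasDensity.le_of_eventually_le (c := u x₀ - v x₀) F hud hvd hposn (by
      filter_upwards [hnhd] with y hy
      linarith [h1 y hy])
    linarith
  suffices hex : ∃ H, PuncturedHarmonic F Ω x₀ H ∧ (∀ y ∈ frontier Ω, H y = φ y) ∧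
      HasDensity h x₀ H Θ by
    obtain ⟨H, hH, hHφ, hHd⟩ := hex
    refine ⟨H, ⟨hH.cont, hH.fharmonicOn hΩo, hHφ, hHd⟩, fun H' ⟨hc, hha, hφ', hd⟩ => ?_⟩
    have hH' : PuncturedHarmonic F Ω x₀ H' := ⟨hc, hha.viscOn.1, hha.viscOn.2⟩
    have he : ∀ y ∈ frontier Ω, H y = H' y := fun y hy => (hHφ y hy).trans (hφ' y hy).symm
    exact hH.eqOn hconv hΩo hΩb hH' he (le_antisymm (hval H H' hH hH' he hHd hd)
      (hval H' H hH' hH (fun y hy => (he y hy).symm) hd hHd))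
  obtain ⟨κ, σ, hκ, hσc, hσ, hσ0, hσn⟩ := exists_barrier hΩo hΩb hbdry
  obtain ⟨H₀, hH₀c, hH₀φ, hH₀F, hH₀d⟩ :=
    exists_harmonic_of_continuousOn hconv hΩo hΩb hκ hσc hσ hσ0 hσn hφ
  have hH₀ : PuncturedHarmonic F Ω x₀ H₀ :=
    ⟨hH₀c, hH₀F.mono Set.sdiff_subset, hH₀d.mono Set.sdiff_subset⟩
  have hdens₀ : HasDensity h x₀ H₀ 0 := hH4 H₀ Ω hΩo hx₀
    (fharmonicOn_of_viscOn hΩo (hH₀c.mono subset_closure) hH₀F hH₀d)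
  rcases hΘ.eq_or_lt with rfl | hΘpos
  · exact ⟨H₀, hH₀, hH₀φ, hdens₀⟩
  have hfam : ∀ c : ℝ, ∃ (H : EucSp n → ℝ) (θ : ℝ), 0 < c → PuncturedHarmonic F Ω x₀ H ∧
      (∀ x ∈ frontier Ω, H x = H₀ x) ∧ H x₀ = H₀ x₀ - c ∧ (∀ x ∈ closure Ω, H x ≤ H₀ x) ∧
      HasDensity h x₀ H θ ∧ c ≤ θ := by
    intro c
    by_cases hc : 0 < c
    swap
    · exact ⟨0, 0, fun h => (hc h).elim⟩
    obtain ⟨H, hH, hHf, hHx, hHle⟩ := exists_puncturedHarmonic_sub hconv hΩo hΩb hx₀ hκ hσc hσ hσ0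
      hσn hh h0 hpos hH₀c hH₀F hH₀d hc
    have hgrow := hh.add_mul_le hconv hΩo hΩb h0 hh1 hH₀ hH (fun x hx => (hHf x hx).symm) hc.le
      (by rw [hHx]; ring)
    have hsub : ViscOn F.carrier Ω H := by
      refine ViscOn.of_mul_le hnotest h0 hH.sub (half_pos hc) ?_
      filter_upwards [hdens₀.eventually_abs_sub_le h0 hposn (half_pos hc), hΩo.mem_nhds hx₀]
        with y hy hyΩ
      linarith [hgrow y (subset_closure hyΩ), (abs_le.1 hy).1]
    obtain ⟨θ, -, hθ⟩ := hH3 H Ω hΩo hx₀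
      (hsub.fsubharmonicOn hΩo (hH.cont.mono subset_closure)) (hH.fharmonicOn hΩo)
    refine ⟨H, θ, fun _ => ⟨hH, hHf, hHx, hHle, hθ, ?_⟩⟩
    have := HasDensity.le_of_eventually_le (c := c) F hdens₀ hθ hposn (by
      filter_upwards [hnhd] with y hy
      linarith [hgrow y hy])
    linarith
  choose H θ hHθ using hfam
  have hconc : ConcaveOn ℝ (Set.Ioi 0) θ := by
    refine ⟨convex_Ioi 0, fun c₁ hc₁ c₂ hc₂ a b ha hb hab => ?_⟩
    have hc : 0 < a • c₁ + b • c₂ := convex_Ioi (0 : ℝ) hc₁ hc₂ ha hb hab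
    obtain ⟨h1, hf1, hx1, -, hd1, -⟩ := hHθ c₁ hc₁
    obtain ⟨h2, hf2, hx2, -, hd2, -⟩ := hHθ c₂ hc₂
    obtain ⟨h3, hf3, hx3, -, hd3, -⟩ := hHθ _ hc
    have hb' : b = 1 - a := by linarith
    have hx : a * H c₁ x₀ + b * H c₂ x₀ = H (a • c₁ + b • c₂) x₀ := by
      rw [hx1, hx2, hx3, hb', smul_eq_mul, smul_eq_mul]; ring
    have hcmp := comparison_punctured hconv hΩo hΩb h1.cont h2.cont h3.cont h1.sub h2.sub h3.sup
      (M := 0) ha hb (fun y hy => by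
        rw [hf1 y hy, hf2 y hy, hf3 y hy, hb']; linarith) (by rw [hx, sub_self])
    have := F.punctured_neBot x₀
    have hlim := (hd1.const_mul a).add (hd2.const_mul b)
    refine le_of_tendsto_of_tendsto hlim hd3 ?_
    filter_upwards [hposn, hnhd] with y hy hyΩ
    rw [mul_div_assoc', mul_div_assoc', ← add_div]
    refine div_le_div_of_nonneg_right ?_ hy.le
    linarith [hcmp y hyΩ]
  obtain ⟨c₁, hc₁, hsmall⟩ := exists_density_le hconv hΩo hx₀ hh h0 hpos hdens₀ hΘpos
  have hθ₁ : θ c₁ ≤ Θ := by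
    obtain ⟨h1, -, hx1, hle1, hd1, -⟩ := hHθ c₁ hc₁
    exact hsmall _ _ h1 hx1 hle1 hd1
  have hc₂ : 0 < max c₁ Θ := lt_max_of_lt_right hΘpos
  have hθ₂ : Θ ≤ θ (max c₁ Θ) := (le_max_right _ _).trans (hHθ _ hc₂).2.2.2.2.2
  have hcont : ContinuousOn θ (Set.Icc c₁ (max c₁ Θ)) :=
    (hconc.continuousOn isOpen_Ioi).mono fun c hc => lt_of_lt_of_le hc₁ hc.1
  obtain ⟨c, hc, hcΘ⟩ := intermediate_value_Icc (le_max_left _ _) hcont ⟨hθ₁, hθ₂⟩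
  obtain ⟨h1, hf1, -, -, hd1, -⟩ := hHθ c (lt_of_lt_of_le hc₁ hc.1)
  exact ⟨H c, h1, fun y hy => (hf1 y hy).trans (hH₀φ y hy), hcΘ ▸ hd1⟩
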